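/- arXiv:2202.08764 — 5 statements merged into one kernel-verified Lean document; each statement's English description precedes it below -/
import Mathlib

section
/- Let k > 1 and let T be any linear 4-tree with k quadruples. Then every T-free linear quadruple system on n vertices has at most (3k−5)·n quadruples; that is, ex^lin_4(n, T) ≤ (3k−5)n. -/
/-- A linear quadruple system on vertex set `Fin n`: a 4-uniform hypergraph in which
every pair of vertices lies in at most one quadruple (equivalently, two distinct
quadruples share at most one vertex). -/
structure LinearQuadSystem (n : ℕ) where
  edges : Finset (Finset (Fin n))
  card_four : ∀ e ∈ edges, e.card = 4
  linear : ∀ e ∈ edges, ∀ f ∈ edges, e ≠ f → (e ∩ f).card ≤ 1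

/-- `e : Fin k → Finset ℕ` is a linear 4-tree with `k` quadruples: each quadruple has
4 vertices and each quadruple (after the first) meets the union of the previous
quadruples in exactly one vertex. -/
def IsLinear4Tree (k : ℕ) (e : Fin k → Finset ℕ) : Prop :=
  (∀ i, (e i).card = 4) ∧
  ∀ i : Fin k, 0 < (i : ℕ) →
    (e i ∩ (Finset.univ.filter (fun j : Fin k => j < i)).biUnion e).card = 1

/-- `H` contains a subhypergraph isomorphic to the 4-graph with edges `e 0, …, e (k-1)`. -/
def ContainsCopy {n k : ℕ} (e : Fin k → Finset ℕ) (H : LinearQuadSystem n) : Prop :=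
  ∃ φ : ℕ → Fin n, Set.InjOn φ ↑(Finset.univ.biUnion e) ∧
    ∀ i, (e i).image φ ∈ H.edges

/-- A set system with more than `d * n` members on `n` vertices has a nonempty subsystem
all of whose nonisolated vertices have degree greater than `d`. -/
lemma exists_subsystem_lt_degree {n d : ℕ} (E : Finset (Finset (Fin n)))
    (hE : d * n < E.card) :
    ∃ F ⊆ E, F.Nonempty ∧ ∀ f ∈ F, ∀ v ∈ f, d < (F.filter (v ∈ ·)).card := by
  classical
  obtain ⟨S, hS, hmin⟩ := Finset.exists_min_image
    ((Finset.univ : Finset (Finset (Fin n))).filter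
      fun S => d * S.card < (E.filter (· ⊆ S)).card) Finset.card
    ⟨Finset.univ, by simpa using hE⟩
  rw [Finset.mem_filter] at hS
  refine ⟨E.filter (· ⊆ S), Finset.filter_subset _ _, ?_, ?_⟩
  · exact Finset.card_pos.1 (by omega)
  · intro f hf v hv
    have hvS : v ∈ S := (Finset.mem_filter.1 hf).2 hv
    have hcard := Finset.card_erase_add_one hvS
    have herase : (E.filter (· ⊆ S.erase v)).card ≤ d * (S.erase v).card := by
      by_contra! h
      have := hmin (S.erase v) (by simpa using h)
      omega
    have hsub : (E.filter (· ⊆ S)).filter (v ∉ ·) ⊆ E.filter (· ⊆ S.erase v) := by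
      intro g hg
      simp only [Finset.mem_filter] at hg ⊢
      exact ⟨hg.1.1, Finset.subset_erase.2 ⟨hg.1.2, hg.2⟩⟩
    have hle := Finset.card_le_card hsub
    have hsplit := Finset.card_filter_add_card_filter_not (s := E.filter (· ⊆ S)) (v ∈ ·)
    have hlt := hS.2
    rw [← hcard, mul_add, mul_one] at hlt
    omega

/-- In a linear system, a vertex of large degree lying on a member contained in `W`
lies on a member meeting `W` in that vertex only. -/
lemma exists_inter_eq_singleton {α : Type*} [DecidableEq α] {F : Finset (Finset α)}
    (hlin : ∀ e ∈ F, ∀ f ∈ F, e ≠ f → (e ∩ f).card ≤ 1) {W g : Finset α} {v : α}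
    (hg : g ∈ F) (hgW : g ⊆ W) (hv : v ∈ g)
    (hdeg : (W \ g).card + 1 < (F.filter (v ∈ ·)).card) :
    ∃ f ∈ F, f ∩ W = {v} := by
  by_contra! hno
  have heq : ∀ f ∈ F, v ∈ f → ∀ f' ∈ F, v ∈ f' → ∀ w, w ≠ v → w ∈ f → w ∈ f' → f = f' := by
    intro f hf hvf f' hf' hvf' w hwv hwf hwf'
    by_contra hne
    exact hwv (Finset.card_le_one.1 (hlin f hf f' hf' hne) w (by simp [hwf, hwf']) v
      (by simp [hvf, hvf']))
  have hmeet : ∀ f ∈ (F.filter (v ∈ ·)).erase g, ∃ w ∈ W \ g, w ∈ f := by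
    intro f hf
    simp only [Finset.mem_erase, Finset.mem_filter] at hf
    by_contra! h
    refine hno f hf.2.1 (Finset.eq_singleton_iff_unique_mem.2
      ⟨by simp [hf.2.2, hgW hv], fun w hw => ?_⟩)
    rw [Finset.mem_inter] at hw
    by_contra hwv
    refine h w (Finset.mem_sdiff.2 ⟨hw.2, fun hwg => ?_⟩) hw.1
    exact hf.1 (heq f hf.2.1 hf.2.2 g hg hv w hwv hw.1 hwg)
  have : Nonempty α := ⟨v⟩
  choose! p hpW hpf using hmeet
  have hcard : ((F.filter (v ∈ ·)).erase g).card ≤ (W \ g).card := by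
    refine Finset.card_le_card_of_injOn p hpW fun f hf f' hf' hff' => ?_
    have hw := hpW f hf
    have hwf := hpf f hf
    have hwf' := hpf f' hf'
    rw [← hff'] at hwf'
    simp only [Finset.coe_erase, Set.mem_sdiff, Finset.mem_coe, Finset.mem_filter] at hf hf'
    refine heq f hf.1.1 hf.1.2 f' hf'.1.1 hf'.1.2 _ ?_ hwf hwf'
    rintro h
    rw [h] at hw
    exact (Finset.mem_sdiff.1 hw).2 hv
  have := Finset.pred_card_le_card_erase (s := F.filter (v ∈ ·)) (a := g)
  omega

/-- A function may be redefined on a finite set so as to map it bijectively onto any finite set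
of the same size. -/
lemma exists_eq_off_injOn_image_eq {α β : Type*} [DecidableEq α] [DecidableEq β] (φ : α → β)
    {s : Finset α} {t : Finset β} (h : s.card = t.card) :
    ∃ ψ : α → β, (∀ x ∉ s, ψ x = φ x) ∧ Set.InjOn ψ s ∧ s.image ψ = t := by
  let E := Finset.equivOfCardEq h
  let ψ : α → β := fun x => if hx : x ∈ s then E ⟨x, hx⟩ else φ x
  have hψ : ∀ x (hx : x ∈ s), ψ x = E ⟨x, hx⟩ := fun x hx => by simp [ψ, hx]
  refine ⟨ψ, fun x hx => by simp [ψ, hx], ?_, ?_⟩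
  · intro x hx y hy hxy
    rw [hψ x hx, hψ y hy] at hxy
    simpa using hxy
  · ext y
    rw [Finset.mem_image]
    constructor
    · rintro ⟨x, hx, rfl⟩
      rw [hψ x hx]
      exact (E ⟨x, hx⟩).2
    · intro hy
      refine ⟨E.symm ⟨y, hy⟩, (E.symm ⟨y, hy⟩).2, ?_⟩
      rw [hψ _ (E.symm ⟨y, hy⟩).2]
      simp

/-- A linear system of quadruples with all degrees greater than `3 * k - 5` contains every initial
segment of a linear 4-tree with `k` quadruples. -/
lemma exists_partial_embedding {n k : ℕ} {e : Fin k → Finset ℕ} (hT : IsLinear4Tree k e)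
    {F : Finset (Finset (Fin n))} (hcard : ∀ f ∈ F, f.card = 4)
    (hlin : ∀ f ∈ F, ∀ g ∈ F, f ≠ g → (f ∩ g).card ≤ 1) (hne : F.Nonempty)
    (hdeg : ∀ f ∈ F, ∀ v ∈ f, 3 * k - 5 < (F.filter (v ∈ ·)).card)
    (m : ℕ) (hm : m + 1 ≤ k) :
    ∃ φ : ℕ → Fin n,
      Set.InjOn φ ↑((Finset.univ.filter fun j : Fin k => (j : ℕ) < m + 1).biUnion e) ∧
      ((Finset.univ.filter fun j : Fin k => (j : ℕ) < m + 1).biUnion e).card ≤ 3 * m + 4 ∧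
      ∀ j : Fin k, (j : ℕ) < m + 1 → (e j).image φ ∈ F := by
  induction m with
  | zero =>
    obtain ⟨f, hf⟩ := hne
    obtain ⟨v, -⟩ : f.Nonempty := Finset.card_pos.1 (by have := hcard f hf; omega)
    have hU : (Finset.univ.filter fun j : Fin k => (j : ℕ) < 0 + 1) = {⟨0, hm⟩} := by
      ext j
      simp [Fin.ext_iff]
    obtain ⟨φ, -, hinj, him⟩ := exists_eq_off_injOn_image_eq (fun _ => v)
      ((hT.1 ⟨0, hm⟩).trans (hcard f hf).symm)
    refine ⟨φ, ?_, ?_, fun j hj => ?_⟩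
    · rwa [hU, Finset.singleton_biUnion]
    · rw [hU, Finset.singleton_biUnion, hT.1]
    · obtain rfl : j = ⟨0, hm⟩ := Fin.ext (by simpa using hj)
      rwa [him]
  | succ m ih =>
    obtain ⟨φ, hinj, hUcard, him⟩ := ih (by omega)
    set U := (Finset.univ.filter fun j : Fin k => (j : ℕ) < m + 1).biUnion e with hUdef
    set i : Fin k := ⟨m + 1, hm⟩ with hi
    have hU' : (Finset.univ.filter fun j : Fin k => (j : ℕ) < m + 1 + 1).biUnion e = e i ∪ U := by
      rw [hUdef, ← Finset.biUnion_insert]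
      congr 1
      ext j
      simp [hi, Fin.ext_iff]
      omega
    have hint : (e i ∩ U).card = 1 := hT.2 i (by simp [hi])
    obtain ⟨u, hu⟩ := Finset.card_eq_one.1 hint
    obtain ⟨hue, huU⟩ := Finset.mem_inter.1 (hu ▸ Finset.mem_singleton_self u : u ∈ e i ∩ U)
    obtain ⟨j, hj, huj⟩ := Finset.mem_biUnion.1 huU
    have hjm : (j : ℕ) < m + 1 := (Finset.mem_filter.1 hj).2
    have hjU : e j ⊆ U := Finset.subset_biUnion_of_mem e hj
    have hgF := him j hjm
    have hgW : (e j).image φ ⊆ U.image φ := Finset.image_subset_image hjU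
    have hvg : φ u ∈ (e j).image φ := Finset.mem_image_of_mem φ huj
    obtain ⟨f, hf, hfW⟩ := exists_inter_eq_singleton hlin hgF hgW hvg (by
      have h1 := hdeg _ hgF _ hvg
      have h2 := Finset.card_sdiff_add_card_eq_card hgW
      have h3 := hcard _ hgF
      have h4 : (U.image φ).card ≤ U.card := Finset.card_image_le
      omega)
    obtain ⟨hvf, -⟩ := Finset.mem_inter.1 (hfW ▸ Finset.mem_singleton_self _ : φ u ∈ f ∩ U.image φ)
    obtain ⟨ψ, hψ, hψinj, hψim⟩ := exists_eq_off_injOn_image_eq φ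
      (s := (e i).erase u) (t := f.erase (φ u))
      (by rw [Finset.card_erase_of_mem hue, Finset.card_erase_of_mem hvf, hT.1, hcard f hf])
    have hψU : ∀ x ∈ U, ψ x = φ x := by
      intro x hx
      refine hψ x fun hxe => ?_
      rw [Finset.mem_erase] at hxe
      exact hxe.1 (Finset.mem_singleton.1 (hu ▸ Finset.mem_inter.2 ⟨hxe.2, hx⟩))
    have hunion : e i ∪ U = (e i).erase u ∪ U := by
      ext x
      by_cases hx : x = u
      · simp [hx, huU]
      · simp [hx]
    refine ⟨ψ, ?_, ?_, fun l hl => ?_⟩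
    · have hsep : ∀ x ∈ (e i).erase u, ∀ y ∈ U, ψ x ≠ ψ y := by
        intro x hx y hy hxy
        have hxf : ψ x ∈ f.erase (φ u) := hψim ▸ Finset.mem_image_of_mem ψ hx
        rw [Finset.mem_erase] at hxf
        refine hxf.1 (Finset.mem_singleton.1 (hfW ▸ Finset.mem_inter.2 ⟨hxf.2, ?_⟩))
        rw [hxy, hψU y hy]
        exact Finset.mem_image_of_mem φ hy
      rw [hU', hunion, Finset.coe_union]
      rintro x (hx | hx) y (hy | hy) hxy
      · exact hψinj hx hy hxy
      · exact (hsep x hx y hy hxy).elim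
      · exact (hsep y hy x hx hxy.symm).elim
      · exact hinj hx hy (by rwa [hψU x hx, hψU y hy] at hxy)
    · rw [hU']
      have := Finset.card_union_add_card_inter (e i) U
      have := hT.1 i
      omega
    · rcases Nat.lt_succ_iff_lt_or_eq.1 hl with hl | hl
      · have : (e l).image ψ = (e l).image φ := Finset.image_congr fun x hx =>
          hψU x (Finset.mem_biUnion.2 ⟨l, by simpa using hl, hx⟩)
        rw [this]
        exact him l hl
      · obtain rfl : l = i := Fin.ext hl
        rw [← Finset.insert_erase hue, Finset.image_insert, hψim, hψU u huU,
          Finset.insert_erase hvf]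
        exact hf

/-- for every linear 4-tree `T` with `k > 1` quadruples, every `T`-free
linear quadruple system on `n` vertices has at most `(3k-5)n` quadruples. -/
theorem linear_turan_tree_upper (k : ℕ) (hk : 1 < k) (e : Fin k → Finset ℕ)
    (hT : IsLinear4Tree k e) (n : ℕ) (H : LinearQuadSystem n)
    (hfree : ¬ ContainsCopy e H) :
    H.edges.card ≤ (3 * k - 5) * n := by
  by_contra! hlt
  obtain ⟨F, hFH, hne, hdeg⟩ := exists_subsystem_lt_degree H.edges hlt
  obtain ⟨φ, hinj, -, him⟩ := exists_partial_embedding hT (fun f hf => H.card_four f (hFH hf))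
    (fun f hf g hg => H.linear f (hFH hf) g (hFH hg)) hne hdeg (k - 1) (by omega)
  have hall : ∀ j : Fin k, (j : ℕ) < k - 1 + 1 := fun j => by omega
  refine hfree ⟨φ, ?_, fun i => hFH (him i (hall i))⟩
  rwa [Finset.filter_true_of_mem fun j _ => hall j] at hinj
end

section
/- Let k ≥ 1 and n be positive integers with (3k−2) | n and 3k−2 ≡ 1 or 4 (mod 12). Then for every linear 4-tree T with k quadruples, ex^lin_4(n, T) ≥ n(k−1)/4; that is, there exists a T-free linear quadruple system on n vertices with at least n(k−1)/4 quadruples. -/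
/-- A group divisible design with block size four and type `3 ^ Y`: blocks are 4-subsets of
`Y × Fin 3` transversal to the groups `{y} × Fin 3`, and any two points from different groups
lie in exactly one block. -/
def HasGDD (Y : Type) : Prop :=
  ∃ B : Set (Finset (Y × Fin 3)), (∀ b ∈ B, b.card = 4) ∧
    (∀ b ∈ B, ∀ p ∈ b, ∀ q ∈ b, p.1 = q.1 → p = q) ∧
    ∀ p q : Y × Fin 3, p.1 ≠ q.1 → ∃! b, b ∈ B ∧ p ∈ b ∧ q ∈ b

/-- A Steiner system with block size four on `X`: any two points lie in exactly one block. -/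
def HasSteiner (X : Type) : Prop :=
  ∃ B : Set (Finset X), (∀ b ∈ B, b.card = 4) ∧
    ∀ p q : X, p ≠ q → ∃! b, b ∈ B ∧ p ∈ b ∧ q ∈ b

/-- Wilson's closure: if the points of `Y` are covered pairwise exactly once by blocks `f i`, each
of which carries a group divisible design, then so does `Y`. -/
theorem HasGDD.of_pairwise {Y ι : Type} (Z : ι → Type) (f : ∀ i, Z i ↪ Y)
    (hZ : ∀ i, HasGDD (Z i))
    (h : ∀ x y : Y, x ≠ y → ∃! i, x ∈ Set.range (f i) ∧ y ∈ Set.range (f i)) : HasGDD Y := by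
  choose B hcard htrans hpair using hZ
  let F : ∀ i, Z i × Fin 3 ↪ Y × Fin 3 := fun i => (f i).prodMap (Function.Embedding.refl _)
  refine ⟨{b | ∃ i, ∃ c ∈ B i, b = c.map (F i)}, ?_, ?_, ?_⟩
  · rintro b ⟨i, c, hc, rfl⟩
    rw [Finset.card_map, hcard i c hc]
  · rintro b ⟨i, c, hc, rfl⟩ p hp q hq hpq
    obtain ⟨p', hp', rfl⟩ := Finset.mem_map.1 hp
    obtain ⟨q', hq', rfl⟩ := Finset.mem_map.1 hq
    rw [htrans i c hc p' hp' q' hq' ((f i).injective hpq)]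
  · rintro ⟨x, s⟩ ⟨y, t⟩ hxy
    obtain ⟨i, ⟨⟨x, rfl⟩, ⟨y, rfl⟩⟩, hi⟩ := h x y hxy
    have hxy' : x ≠ y := fun e => hxy (by simp [e])
    obtain ⟨c, ⟨hc, hp, hq⟩, huniq⟩ := hpair i (x, s) (y, t) hxy'
    refine ⟨c.map (F i), ⟨⟨i, c, hc, rfl⟩, Finset.mem_map_of_mem (F i) hp,
      Finset.mem_map_of_mem (F i) hq⟩, ?_⟩
    rintro b ⟨⟨j, d, hd, rfl⟩, hp', hq'⟩
    obtain ⟨⟨x', s'⟩, hx', ex⟩ := Finset.mem_map.1 hp'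
    obtain ⟨⟨y', t'⟩, hy', ey⟩ := Finset.mem_map.1 hq'
    have ex' : f j x' = f i x ∧ s' = s := Prod.ext_iff.1 ex
    have ey' : f j y' = f i y ∧ t' = t := Prod.ext_iff.1 ey
    obtain rfl : j = i := hi j ⟨⟨x', ex'.1⟩, ⟨y', ey'.1⟩⟩
    obtain rfl := (f j).injective ex'.1
    obtain rfl := (f j).injective ey'.1
    obtain rfl := ex'.2
    obtain rfl := ey'.2
    rw [huniq d ⟨hd, hx', hy'⟩]

theorem HasGDD.of_equiv {Y Z : Type} (e : Z ≃ Y) (h : HasGDD Z) : HasGDD Y :=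
  .of_pairwise (ι := Unit) (fun _ => Z) (fun _ => e.toEmbedding) (fun _ => h) fun x y _ =>
    ⟨(), by simp, fun _ _ => rfl⟩

theorem HasGDD.of_card {Y Z : Type} [Finite Y] [Finite Z] (h : HasGDD Z)
    (e : Nat.card Z = Nat.card Y) : HasGDD Y :=
  h.of_equiv (Finite.card_eq.1 e).some

theorem HasGDD.of_subsingleton (Y : Type) [Subsingleton Y] : HasGDD Y :=
  ⟨∅, by simp, by simp, fun p q h => (h (Subsingleton.elim _ _)).elim⟩

/-- Adding a point at infinity to a group divisible design gives a Steiner system. -/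
theorem HasGDD.hasSteiner {Y : Type} (h : HasGDD Y) : HasSteiner (Option (Y × Fin 3)) := by
  classical
  obtain ⟨B, hcard, htrans, hpair⟩ := h
  let g : Y → Finset (Y × Fin 3) := fun y => {y} ×ˢ Finset.univ
  have hg : ∀ y p, some p ∈ (g y).insertNone ↔ p.1 = y := by
    rintro y ⟨x, c⟩
    simp [g, eq_comm]
  have hnone : ∀ c : Finset (Y × Fin 3), none ∉ c.map Function.Embedding.some := by simp
  have hsome : ∀ (c : Finset (Y × Fin 3)) p, some p ∈ c.map Function.Embedding.some ↔ p ∈ c := by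
    simp
  refine ⟨{b | (∃ c ∈ B, b = c.map .some) ∨ ∃ y, b = (g y).insertNone}, ?_, ?_⟩
  · rintro b (⟨c, hc, rfl⟩ | ⟨y, rfl⟩)
    · rw [Finset.card_map, hcard c hc]
    · simp [g]
  · rintro (_ | p) (_ | q) hpq
    · exact (hpq rfl).elim
    · refine ⟨(g q.1).insertNone, ⟨Or.inr ⟨_, rfl⟩, by simp, (hg _ _).2 rfl⟩, ?_⟩
      rintro b ⟨⟨c, hc, rfl⟩ | ⟨y, rfl⟩, hp, hq⟩
      · exact (hnone c hp).elim
      · rw [(hg _ _).1 hq]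
    · refine ⟨(g p.1).insertNone, ⟨Or.inr ⟨_, rfl⟩, (hg _ _).2 rfl, by simp⟩, ?_⟩
      rintro b ⟨⟨c, hc, rfl⟩ | ⟨y, rfl⟩, hp, hq⟩
      · exact (hnone c hq).elim
      · rw [(hg _ _).1 hp]
    · by_cases e : p.1 = q.1
      · refine ⟨(g p.1).insertNone, ⟨Or.inr ⟨_, rfl⟩, (hg _ _).2 rfl, (hg _ _).2 e.symm⟩, ?_⟩
        rintro b ⟨⟨c, hc, rfl⟩ | ⟨y, rfl⟩, hp, hq⟩
        · exact (hpq (congrArg some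
            (htrans c hc p ((hsome _ _).1 hp) q ((hsome _ _).1 hq) e))).elim
        · rw [(hg _ _).1 hp]
      · obtain ⟨c, ⟨hc, hp, hq⟩, huniq⟩ := hpair p q e
        refine ⟨c.map .some, ⟨Or.inl ⟨c, hc, rfl⟩, (hsome _ _).2 hp, (hsome _ _).2 hq⟩, ?_⟩
        rintro b ⟨⟨d, hd, rfl⟩ | ⟨y, rfl⟩, hp', hq'⟩
        · rw [huniq d ⟨hd, (hsome _ _).1 hp', (hsome _ _).1 hq'⟩]
        · exact (e (((hg _ _).1 hp').trans ((hg _ _).1 hq').symm)).elim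

theorem HasSteiner.hasGDD {X : Type} (h : HasSteiner X) (h4 : HasGDD (Fin 4)) : HasGDD X := by
  obtain ⟨B, hcard, hpair⟩ := h
  refine .of_pairwise (ι := B) (fun b => b.1) (fun b => .subtype _)
    (fun b => h4.of_card (by simp [hcard b.1 b.2])) fun x y hxy => ?_
  obtain ⟨b, ⟨hb, hx, hy⟩, huniq⟩ := hpair x y hxy
  refine ⟨⟨b, hb⟩, by simpa using ⟨hx, hy⟩, ?_⟩
  rintro ⟨c, hc⟩ hxy'
  exact Subtype.ext (huniq c ⟨hc, by simpa using hxy'⟩)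

/-- A transversal design of block size five over a finite commutative ring, with its last group
truncated to `S` and the points `E` added to every group. -/
theorem HasGDD.of_ring {R : Type} [CommRing R] [Finite R] (a : Fin 4 → R)
    (ha : ∀ i j, i ≠ j → IsUnit (a i - a j)) (S : Set R) (E : Type) [Subsingleton E]
    (h4 : HasGDD (Fin 4)) (h5 : HasGDD (Fin 5))
    (hR : HasGDD (R ⊕ E)) (hS : HasGDD (S ⊕ E)) : HasGDD (((Fin 4 × R) ⊕ S) ⊕ E) := by
  have : Finite E := Finite.of_subsingleton
  let P : (R × R) ⊕ Option (Fin 4) → ((Fin 4 × R) ⊕ S) ⊕ E → Prop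
    | .inl v, .inl (.inl p) => p.2 = v.1 + a p.1 * v.2
    | .inl v, .inl (.inr s) => s.1 = v.2
    | .inl _, .inr _ => False
    | .inr (some i), .inl (.inl p) => p.1 = i
    | .inr (some _), .inl (.inr _) => False
    | .inr none, .inl (.inl _) => False
    | .inr none, .inl (.inr _) => True
    | .inr _, .inr _ => True
  refine .of_pairwise (fun i => {p // P i p}) (fun i => .subtype _) ?_ ?_
  · rintro (v | (_ | i))
    · by_cases hv : v.2 ∈ S
      · let e : Option (Fin 4) ≃ {p // P (.inl v) p} :=
          { toFun := fun o => match o with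
              | some i => ⟨.inl (.inl (i, v.1 + a i * v.2)), rfl⟩
              | none => ⟨.inl (.inr ⟨v.2, hv⟩), rfl⟩
            invFun := fun p => match p with
              | ⟨.inl (.inl p), _⟩ => some p.1
              | ⟨.inl (.inr _), _⟩ => none
              | ⟨.inr _, h⟩ => h.elim
            left_inv := by rintro (_ | i) <;> rfl
            right_inv := by
              rintro ⟨((⟨i, z⟩ | ⟨s, hs⟩) | e), hp⟩
              · have hp' : z = v.1 + a i * v.2 := hp
                subst hp'; rfl
              · have hp' : s = v.2 := hp
                subst hp'; rfl
              · exact hp.elim }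
        exact HasGDD.of_equiv e (h5.of_card (by simp))
      · let e : Fin 4 ≃ {p // P (.inl v) p} :=
          { toFun := fun i => ⟨.inl (.inl (i, v.1 + a i * v.2)), rfl⟩
            invFun := fun p => match p with
              | ⟨.inl (.inl p), _⟩ => p.1
              | ⟨.inl (.inr s), h⟩ => (hv (show v.2 ∈ S from h ▸ s.2)).elim
              | ⟨.inr _, h⟩ => h.elim
            left_inv := fun _ => rfl
            right_inv := by
              rintro ⟨((⟨i, z⟩ | ⟨s, hs⟩) | e), hp⟩
              · have hp' : z = v.1 + a i * v.2 := hp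
                subst hp'; rfl
              · have hp' : s = v.2 := hp
                exact (hv (hp' ▸ hs)).elim
              · exact hp.elim }
        exact HasGDD.of_equiv e h4
    · let e : S ⊕ E ≃ {p // P (.inr none) p} :=
        { toFun := fun o => match o with
            | .inl s => ⟨.inl (.inr s), trivial⟩
            | .inr x => ⟨.inr x, trivial⟩
          invFun := fun p => match p with
            | ⟨.inl (.inl _), h⟩ => h.elim
            | ⟨.inl (.inr s), _⟩ => .inl s
            | ⟨.inr x, _⟩ => .inr x
          left_inv := by rintro (_ | _) <;> rfl
          right_inv := by
            rintro ⟨((⟨i, z⟩ | ⟨s, hs⟩) | e), hp⟩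
            · exact hp.elim
            · rfl
            · rfl }
      exact HasGDD.of_equiv e hS
    · let e : R ⊕ E ≃ {p // P (.inr (some i)) p} :=
        { toFun := fun o => match o with
            | .inl z => ⟨.inl (.inl (i, z)), rfl⟩
            | .inr x => ⟨.inr x, trivial⟩
          invFun := fun p => match p with
            | ⟨.inl (.inl p), _⟩ => .inl p.2
            | ⟨.inl (.inr _), h⟩ => h.elim
            | ⟨.inr x, _⟩ => .inr x
          left_inv := by rintro (_ | _) <;> rfl
          right_inv := by
            rintro ⟨((⟨j, z⟩ | ⟨s, hs⟩) | e), hp⟩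
            · have hp' : j = i := hp
              subst hp'; rfl
            · exact hp.elim
            · rfl }
      exact HasGDD.of_equiv e hR
  · have key : ∀ x y, x ≠ y → ∃! i, P i x ∧ P i y := by
      rintro ((⟨i, z⟩ | s) | x) ((⟨j, w⟩ | s') | y) hne
      · by_cases hij : i = j
        · subst hij
          refine ⟨.inr (some i), ⟨rfl, rfl⟩, ?_⟩
          rintro (v | (_ | k)) ⟨h1, h2⟩
          · exact (hne (by rw [show z = w from Eq.trans h1 (Eq.symm h2)])).elim
          · exact h1.elim
          · rw [show i = k from h1]
        · obtain ⟨u, hu⟩ := ha i j hij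
          have hu' : (↑u⁻¹ : R) * (a i - a j) = 1 := by rw [← hu]; simp
          refine ⟨.inl (z - a i * (↑u⁻¹ * (z - w)), ↑u⁻¹ * (z - w)), ⟨?_, ?_⟩, ?_⟩
          · change z = _ + _
            ring
          · change w = (z - a i * (↑u⁻¹ * (z - w))) + a j * (↑u⁻¹ * (z - w))
            linear_combination (z - w) * hu'
          · rintro (⟨v, v'⟩ | (_ | k)) ⟨h1, h2⟩
            · have h1' : z = v + a i * v' := h1
              have h2' : w = v + a j * v' := h2
              have e2 : v' = ↑u⁻¹ * (z - w) := by
                rw [h1', h2']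
                linear_combination (-v') * hu'
              have e1 : v = z - a i * (↑u⁻¹ * (z - w)) := by
                rw [← e2, h1']; ring
              rw [← e1, ← e2]
            · exact h1.elim
            · exact (hij (Eq.trans h1 (Eq.symm h2))).elim
      · refine ⟨.inl (z - a i * s', s'), ⟨?_, rfl⟩, ?_⟩
        · change z = _ + _
          ring
        · rintro (⟨v, v'⟩ | (_ | k)) ⟨h1, h2⟩
          · have h1' : z = v + a i * v' := h1
            have h2' : s'.1 = v' := h2
            rw [h1', ← h2']; simp
          · exact h1.elim
          · exact h2.elim
      · refine ⟨.inr (some i), ⟨rfl, trivial⟩, ?_⟩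
        rintro (v | (_ | k)) ⟨h1, h2⟩
        · exact h2.elim
        · exact h1.elim
        · rw [show i = k from h1]
      · refine ⟨.inl (w - a j * s, s), ⟨rfl, ?_⟩, ?_⟩
        · change w = _ + _
          ring
        · rintro (⟨v, v'⟩ | (_ | k)) ⟨h1, h2⟩
          · have h1' : w = v + a j * v' := h2
            have h2' : s.1 = v' := h1
            rw [h1', ← h2']; simp
          · exact h2.elim
          · exact h1.elim
      · refine ⟨.inr none, ⟨trivial, trivial⟩, ?_⟩
        rintro (v | (_ | k)) ⟨h1, h2⟩
        · exact (hne (by rw [Subtype.ext (Eq.trans h1 (Eq.symm h2))])).elim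
        · rfl
        · exact h1.elim
      · refine ⟨.inr none, ⟨trivial, trivial⟩, ?_⟩
        rintro (v | (_ | k)) ⟨h1, h2⟩
        · exact h2.elim
        · rfl
        · exact h1.elim
      · refine ⟨.inr (some j), ⟨trivial, rfl⟩, ?_⟩
        rintro (v | (_ | k)) ⟨h1, h2⟩
        · exact h1.elim
        · exact h2.elim
        · rw [show j = k from h2]
      · refine ⟨.inr none, ⟨trivial, trivial⟩, ?_⟩
        rintro (v | (_ | k)) ⟨h1, h2⟩
        · exact h1.elim
        · rfl
        · exact h2.elim
      · exact (hne (by rw [Subsingleton.elim x y])).elim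
    intro x y hxy
    simpa using key x y hxy

/-- Checks that `L` lists the blocks of a group divisible design of type `3 ^ r`, the point
`(y, c)` being encoded as `3 * y + c`. -/
def isGDDList (r : ℕ) (L : List (List ℕ)) : Bool :=
  (L.all fun b => b.length == 4 && b.Nodup && b.all fun p => p < 3 * r && b.all fun q =>
    p / 3 != q / 3 || p == q) &&
  (List.range (3 * r)).all fun p => (List.range (3 * r)).all fun q =>
    p / 3 == q / 3 || ((L.filter (·.contains p)).filter (·.contains q)).length == 1

/-- The translates of the blocks `D` by `ZMod m × ZMod 3`, the points `(m, c)` being at infinity. -/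
def translates (m : ℕ) (D : List (List ℕ)) : List (List ℕ) :=
  (List.range m).flatMap fun x => (List.range 3).flatMap fun c =>
    D.map (List.map fun p =>
      3 * (if p / 3 = m then m else (p / 3 + x) % m) + (p + c) % 3)

theorem HasGDD.of_list {r : ℕ} {L : List (List ℕ)} (h : isGDDList r L = true) :
    HasGDD (Fin r) := by
  simp only [isGDDList, Bool.and_eq_true, List.all_eq_true, List.mem_range, beq_iff_eq,
    decide_eq_true_eq, Bool.or_eq_true, bne_iff_ne] at h
  obtain ⟨hL, hpair⟩ := h
  let enc : Fin r × Fin 3 → ℕ := fun p => 3 * p.1 + p.2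
  have henc : ∀ p, enc p / 3 = p.1 := fun p => by simp only [enc]; omega
  have henclt : ∀ p, enc p < 3 * r := fun p => by simp only [enc]; omega
  have hinj : Function.Injective enc := by
    intro p q hpq
    simp only [enc] at hpq
    ext <;> omega
  have hsurj : ∀ n, n < 3 * r → ∃ p, enc p = n := fun n hn =>
    ⟨(⟨n / 3, by omega⟩, ⟨n % 3, by omega⟩), by simp only [enc]; omega⟩
  let F : List ℕ → Finset (Fin r × Fin 3) := fun b => Finset.univ.filter fun p => enc p ∈ b
  have hF : ∀ b p, p ∈ F b ↔ enc p ∈ b := by simp [F]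
  refine ⟨{b | ∃ c ∈ L, b = F c}, ?_, ?_, fun p q hpq => ?_⟩
  · rintro _ ⟨c, hc, rfl⟩
    obtain ⟨⟨hlen, hnodup⟩, hlt⟩ := hL c hc
    rw [← hlen, ← List.toFinset_card_of_nodup hnodup, ← Finset.card_image_of_injective _ hinj]
    congr 1
    ext n
    simp only [Finset.mem_image, hF, List.mem_toFinset]
    refine ⟨?_, fun hn => ?_⟩
    · rintro ⟨p, hp, rfl⟩
      exact hp
    · obtain ⟨p, rfl⟩ := hsurj n (hlt n hn).1
      exact ⟨p, hn, rfl⟩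
  · rintro _ ⟨c, hc, rfl⟩ p hp q hq hpq
    refine hinj (((((hL c hc).2 _ ((hF _ _).1 hp)).2 _ ((hF _ _).1 hq))).resolve_left ?_)
    rw [henc, henc, hpq]
    simp
  · have h1 := (hpair _ (henclt p) _ (henclt q)).resolve_left
      (by rw [henc, henc]; exact fun h => hpq (Fin.ext h))
    obtain ⟨b, hb⟩ := List.length_eq_one_iff.1 h1
    have hmem : ∀ c, (c ∈ L ∧ enc p ∈ c ∧ enc q ∈ c) ↔ c = b := by
      intro c
      rw [← List.mem_singleton, ← hb]
      simp only [List.mem_filter, List.contains_iff_mem, and_assoc]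
    obtain ⟨h1, h2, h3⟩ := (hmem b).2 rfl
    refine ⟨F b, ⟨⟨b, h1, rfl⟩, (hF _ _).2 h2, (hF _ _).2 h3⟩, ?_⟩
    rintro _ ⟨⟨c, hc, rfl⟩, hp, hq⟩
    rw [(hmem c).1 ⟨hc, (hF _ _).1 hp, (hF _ _).1 hq⟩]

theorem hasGDD_four : HasGDD (Fin 4) :=
  .of_list (L := [[0, 3, 6, 9], [0, 4, 7, 10], [0, 5, 8, 11], [1, 3, 7, 11], [1, 4, 8, 9],
    [1, 5, 6, 10], [2, 3, 8, 10], [2, 4, 6, 11], [2, 5, 7, 9]]) (by decide +kernel)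

theorem hasGDD_five : HasGDD (Fin 5) :=
  .of_list (L := translates 5 [[0, 3, 7, 13]]) (by decide +kernel)

theorem hasGDD_eight : HasGDD (Fin 8) :=
  .of_list (L := translates 7 [[21, 0, 4, 11], [0, 3, 8, 15]]) (by decide +kernel)

theorem hasGDD_nine : HasGDD (Fin 9) :=
  .of_list (L := (List.range 3).flatMap fun x => (List.range 3).flatMap fun y =>
    (List.range 3).flatMap fun c => [[0, 3, 9, 13], [0, 5, 16, 24]].map (List.map fun p =>
      9 * ((p / 9 + x) % 3) + 3 * ((p / 3 + y) % 3) + (p + c) % 3)) (by decide +kernel)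

theorem hasGDD_twelve : HasGDD (Fin 12) :=
  .of_list (L := translates 11 [[33, 0, 4, 11], [0, 3, 9, 22], [0, 5, 12, 20]])
    (by decide +kernel)

theorem hasGDD_zero_or_one (r : ℕ) (h : r ≤ 1) : HasGDD (Fin r) :=
  have := Fin.subsingleton_iff_le_one.2 h
  .of_subsingleton _

/-- The closure of the admissible orders under `r ↦ 3 * r + 1`. -/
theorem HasGDD.three_mul_add_one {r : ℕ} (h : HasGDD (Fin r)) : HasGDD (Fin (3 * r + 1)) :=
  (h.hasSteiner.hasGDD hasGDD_four).of_card (by simp [mul_comm])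

theorem HasGDD.four_mul_add {R : Type} [CommRing R] [Finite R] (a : Fin 4 → R)
    (ha : ∀ i j, i ≠ j → IsUnit (a i - a j)) (h ε : ℕ) (hh : h ≤ Nat.card R) (hε : ε ≤ 1)
    (hR : HasGDD (Fin (Nat.card R + ε))) (hS : HasGDD (Fin (h + ε))) :
    HasGDD (Fin (4 * Nat.card R + h + ε)) := by
  classical
  have := Fintype.ofFinite R
  have := Fin.subsingleton_iff_le_one.2 hε
  obtain ⟨S, -, hScard⟩ := Finset.exists_subset_card_eq (s := (Finset.univ : Finset R)) (n := h)
    (by rwa [Finset.card_univ, ← Nat.card_eq_fintype_card])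
  refine (HasGDD.of_ring a ha (S : Set R) (Fin ε) hasGDD_four hasGDD_five (hR.of_card ?_)
    (hS.of_card ?_)).of_card ?_
  · simp
  · simp [hScard]
  · simp [hScard]

theorem HasGDD.four_mul_add_of_coprime {t : ℕ} (ht : t.Coprime 6) (h ε : ℕ) (hh : h ≤ t)
    (hε : ε ≤ 1) (hR : HasGDD (Fin (t + ε))) (hS : HasGDD (Fin (h + ε))) :
    HasGDD (Fin (4 * t + h + ε)) := by
  have h2 : IsUnit ((2 : ℕ) : ZMod t) :=
    (ZMod.isUnit_iff_coprime 2 t).2 (ht.symm.coprime_dvd_left (by norm_num))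
  have h3 : IsUnit ((3 : ℕ) : ZMod t) :=
    (ZMod.isUnit_iff_coprime 3 t).2 (ht.symm.coprime_dvd_left (by norm_num))
  have : NeZero t := ⟨by rintro rfl; norm_num at ht⟩
  have key := HasGDD.four_mul_add (R := ZMod t) (fun i : Fin 4 => ((i : ℕ) : ZMod t)) ?_ h ε
    (by simpa using hh) hε (by simpa using hR) hS
  · simpa using key
  · have main : ∀ i j : Fin 4, i < j → IsUnit (((j : ℕ) : ZMod t) - ((i : ℕ) : ZMod t)) := by
      intro i j hij
      rw [← Nat.cast_sub hij.le]
      have : (j : ℕ) - i = 1 ∨ (j : ℕ) - i = 2 ∨ (j : ℕ) - i = 3 := by omega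
      rcases this with e | e | e <;> rw [e]
      · simp
      · exact h2
      · exact h3
    intro i j hij
    rcases lt_or_gt_of_ne hij with h | h
    · rw [← neg_sub]
      exact (main i j h).neg
    · exact main j i h

theorem HasGDD.four_mul_add_of_field {F : Type} [Field F] [Finite F] (hF : 4 ≤ Nat.card F) (h : ℕ)
    (hh : h ≤ Nat.card F) (hR : HasGDD (Fin (Nat.card F))) (hS : HasGDD (Fin h)) :
    HasGDD (Fin (4 * Nat.card F + h)) := by
  have := Fintype.ofFinite F
  obtain ⟨a⟩ : Nonempty (Fin 4 ↪ F) := Function.Embedding.nonempty_of_card_le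
    (by rwa [Fintype.card_fin, ← Nat.card_eq_fintype_card])
  exact HasGDD.four_mul_add a (fun i j hij => (sub_ne_zero.2 (a.injective.ne hij)).isUnit) h 0 hh
    (by simp) hR hS

theorem HasGDD.sixteen_add (h : ℕ) (hh : h ≤ 4) (hS : HasGDD (Fin h)) : HasGDD (Fin (16 + h)) := by
  have : Fact (Nat.Prime 2) := ⟨Nat.prime_two⟩
  have hc : Nat.card (GaloisField 2 2) = 4 := by rw [GaloisField.card] <;> norm_num
  have := HasGDD.four_mul_add_of_field (F := GaloisField 2 2) hc.ge h (by rwa [hc])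
    (by rw [hc]; exact hasGDD_four) hS
  rwa [hc] at this

theorem HasGDD.thirtysix_add (h : ℕ) (hh : h ≤ 9) (hS : HasGDD (Fin h)) :
    HasGDD (Fin (36 + h)) := by
  have : Fact (Nat.Prime 3) := ⟨Nat.prime_three⟩
  have hc : Nat.card (GaloisField 3 2) = 9 := by rw [GaloisField.card] <;> norm_num
  have := HasGDD.four_mul_add_of_field (F := GaloisField 3 2) (by rw [hc]; norm_num) h (by rwa [hc])
    (by rw [hc]; exact hasGDD_nine) hS
  rwa [hc] at this

theorem coprime_six_of_mod {t : ℕ} (h : t % 6 = 1 ∨ t % 6 = 5) : t.Coprime 6 := by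
  rw [Nat.Coprime, Nat.gcd_comm, Nat.gcd_rec]
  rcases h with h | h <;> rw [h] <;> norm_num

/-- Every admissible order `r ≥ 29`, up to four exceptions, is the order of a truncated
transversal design with groups of size `t` coprime to `6`. -/
theorem exists_truncation {r : ℕ} (hr : 29 ≤ r) (hmod : r % 4 = 0 ∨ r % 4 = 1)
    (h1 : r ≠ 37) (h2 : r ≠ 40) (h3 : r ≠ 41) (h4 : r ≠ 44) :
    ∃ t h ε, r = 4 * t + h + ε ∧ (t % 6 = 1 ∨ t % 6 = 5) ∧ h ≤ t ∧ ε ≤ 1 ∧ 1 < t ∧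
      ((t + ε) % 4 = 0 ∨ (t + ε) % 4 = 1) ∧ ((h + ε) % 4 = 0 ∨ (h + ε) % 4 = 1) := by
  rcases lt_or_ge r 100 with hlt | hge
  · by_cases c1 : r ≤ 36
    · exact ⟨7, r - 29, 1, by omega⟩
    by_cases c2 : r = 45 ∨ r ≤ 49
    · exact ⟨11, r - 45, 1, by omega⟩
    by_cases c3 : r ≤ 65
    · exact ⟨13, r - 52, 0, by omega⟩
    by_cases c4 : r ≤ 85
    · exact ⟨17, r - 68, 0, by omega⟩
    by_cases c5 : r ≤ 96
    · exact ⟨19, r - 77, 1, by omega⟩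
    · exact ⟨23, r - 93, 1, by omega⟩
  · by_cases c : (r - 4) % 48 < 16
    · exact ⟨12 * ((r - 4) / 48) + 1, (r - 4) % 48, 0, by omega⟩
    · exact ⟨12 * ((r - 4) / 48) + 5, (r - 4) % 48 - 16, 0, by omega⟩

theorem hasGDD_of_mod (r : ℕ) (hmod : r % 4 = 0 ∨ r % 4 = 1) : HasGDD (Fin r) := by
  induction r using Nat.strong_induction_on with
  | _ r ih =>
  by_cases hlarge : 29 ≤ r ∧ r ≠ 37 ∧ r ≠ 40 ∧ r ≠ 41 ∧ r ≠ 44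
  · obtain ⟨hr, h1, h2, h3, h4⟩ := hlarge
    obtain ⟨t, h, ε, rfl, ht, hh, hε, h1t, htm, hhm⟩ := exists_truncation hr hmod h1 h2 h3 h4
    exact HasGDD.four_mul_add_of_coprime (coprime_six_of_mod ht) h ε hh hε
      (ih _ (by omega) htm) (ih _ (by omega) hhm)
  have hsmall : r ≤ 1 ∨ r = 4 ∨ r = 5 ∨ r = 8 ∨ r = 9 ∨ r = 12 ∨ r = 13 ∨ r = 16 ∨ r = 17 ∨
      (20 ≤ r ∧ r ≤ 25) ∨ r = 28 ∨ (36 ≤ r ∧ r ≤ 44) := by omega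
  rcases hsmall with h | rfl | rfl | rfl | rfl | rfl | rfl | rfl | rfl | h | rfl | h
  · exact hasGDD_zero_or_one r h
  · exact hasGDD_four
  · exact hasGDD_five
  · exact hasGDD_eight
  · exact hasGDD_nine
  · exact hasGDD_twelve
  · exact hasGDD_four.three_mul_add_one
  · exact hasGDD_five.three_mul_add_one
  · exact HasGDD.sixteen_add 1 (by norm_num) (hasGDD_zero_or_one 1 le_rfl)
  · obtain ⟨s, rfl⟩ := Nat.exists_eq_add_of_le h.1
    exact HasGDD.four_mul_add_of_coprime (t := 5) (by norm_num) s 0 (by omega) (by norm_num)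
      hasGDD_five (ih s (by omega) (by omega))
  · exact hasGDD_nine.three_mul_add_one
  · obtain ⟨s, rfl⟩ := Nat.exists_eq_add_of_le h.1
    exact HasGDD.thirtysix_add s (by omega) (ih s (by omega) (by omega))

theorem HasSteiner.of_equiv {X Y : Type} (e : X ≃ Y) (h : HasSteiner X) : HasSteiner Y := by
  obtain ⟨B, hcard, hpair⟩ := h
  have hmem : ∀ (c : Finset X) y, y ∈ c.map e.toEmbedding ↔ e.symm y ∈ c := fun c y => by
    rw [Finset.mem_map_equiv]
  refine ⟨{b | ∃ c ∈ B, b = c.map e.toEmbedding}, ?_, fun p q hpq => ?_⟩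
  · rintro _ ⟨c, hc, rfl⟩
    rw [Finset.card_map, hcard c hc]
  · obtain ⟨c, ⟨hc, hp, hq⟩, huniq⟩ := hpair (e.symm p) (e.symm q) (e.symm.injective.ne hpq)
    refine ⟨_, ⟨⟨c, hc, rfl⟩, (hmem _ _).2 hp, (hmem _ _).2 hq⟩, ?_⟩
    rintro _ ⟨⟨d, hd, rfl⟩, hp', hq'⟩
    rw [huniq d ⟨hd, (hmem _ _).1 hp', (hmem _ _).1 hq'⟩]

/-- Hanani's theorem. -/
theorem hasSteiner_of_mod {m : ℕ} (hm : m % 12 = 1 ∨ m % 12 = 4) : HasSteiner (Fin m) := by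
  obtain ⟨r, rfl⟩ : ∃ r, m = 3 * r + 1 := ⟨m / 3, by omega⟩
  exact (hasGDD_of_mod r (by omega)).hasSteiner.of_equiv
    (Finite.card_eq.1 (by simp [mul_comm])).some

/-- The disjoint union of copies of a Steiner system. -/
theorem exists_linearQuadSystem_of_hasSteiner {m s n : ℕ} (hm : HasSteiner (Fin m))
    (hn : s * m = n) : ∃ (H : LinearQuadSystem n) (comp : Fin n → Fin s),
      (∀ b ∈ H.edges, ∀ p ∈ b, ∀ q ∈ b, comp p = comp q) ∧
      (∀ c, (Finset.univ.filter fun p => comp p = c).card = m) ∧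
      ∀ p q, p ≠ q → comp p = comp q → ∃ b ∈ H.edges, p ∈ b ∧ q ∈ b := by
  classical
  subst hn
  obtain ⟨B, hcard, hpair⟩ := hm
  let ψ : Fin s → Fin m ↪ Fin (s * m) := fun c =>
    ⟨fun x => finProdFinEquiv (c, x), fun x y h => by simpa using h⟩
  let comp : Fin (s * m) → Fin s := fun p => (finProdFinEquiv.symm p).1
  have hψ : ∀ c x, comp (ψ c x) = c := fun c x =>
    congrArg Prod.fst (finProdFinEquiv.symm_apply_apply (c, x))
  have hsurj : ∀ p, ∃ x, p = ψ (comp p) x := fun p =>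
    ⟨(finProdFinEquiv.symm p).2, (finProdFinEquiv.apply_symm_apply p).symm⟩
  let E : Finset (Finset (Fin (s * m))) :=
    Finset.univ.filter fun b => ∃ c, ∃ d ∈ B, b = d.map (ψ c)
  have hE : ∀ b, b ∈ E ↔ ∃ c, ∃ d ∈ B, b = d.map (ψ c) := by simp [E]
  have hcomp : ∀ b ∈ E, ∀ p ∈ b, ∀ q ∈ b, comp p = comp q := by
    intro b hb p hp q hq
    obtain ⟨c, d, -, rfl⟩ := (hE b).1 hb
    obtain ⟨x, -, rfl⟩ := Finset.mem_map.1 hp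
    obtain ⟨y, -, rfl⟩ := Finset.mem_map.1 hq
    rw [hψ, hψ]
  refine ⟨⟨E, ?_, ?_⟩, comp, hcomp, ?_, ?_⟩
  · intro b hb
    obtain ⟨c, d, hd, rfl⟩ := (hE b).1 hb
    rw [Finset.card_map, hcard d hd]
  · intro b hb b' hb' hne
    by_contra! hlt
    obtain ⟨p, hp, q, hq, hpq⟩ := Finset.one_lt_card.1 hlt
    rw [Finset.mem_inter] at hp hq
    obtain ⟨c, d, hd, rfl⟩ := (hE b).1 hb
    obtain ⟨c', d', hd', rfl⟩ := (hE b').1 hb'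
    obtain ⟨x, hx, rfl⟩ := Finset.mem_map.1 hp.1
    obtain ⟨y, hy, rfl⟩ := Finset.mem_map.1 hq.1
    obtain ⟨x', hx', ex⟩ := Finset.mem_map.1 hp.2
    obtain ⟨y', hy', ey⟩ := Finset.mem_map.1 hq.2
    obtain rfl : c' = c := by rw [← hψ c' x', ex, hψ]
    obtain rfl := (ψ c').injective ex
    obtain rfl := (ψ c').injective ey
    have hxy : x' ≠ y' := fun h => hpq (by rw [h])
    exact hne (by rw [(hpair x' y' hxy).unique ⟨hd, hx, hy⟩ ⟨hd', hx', hy'⟩])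
  · intro c
    have : (Finset.univ.filter fun p => comp p = c) = Finset.univ.map (ψ c) := by
      ext p
      simp only [Finset.mem_filter, Finset.mem_univ, true_and, Finset.mem_map]
      refine ⟨?_, ?_⟩
      · rintro rfl
        obtain ⟨x, hx⟩ := hsurj p
        exact ⟨x, hx.symm⟩
      · rintro ⟨x, rfl⟩
        exact hψ c x
    rw [this, Finset.card_map, Finset.card_univ, Fintype.card_fin]
  · intro p q hpq hc
    obtain ⟨x, hx⟩ := hsurj p
    obtain ⟨y, hy⟩ := hsurj q
    rw [← hc] at hy
    have hxy : x ≠ y := fun h => hpq (by rw [hx, hy, h])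
    obtain ⟨d, ⟨hd, hxd, hyd⟩, -⟩ := hpair x y hxy
    refine ⟨d.map (ψ (comp p)), (hE _).2 ⟨_, d, hd, rfl⟩, ?_, ?_⟩
    · rw [hx, hψ]
      exact Finset.mem_map_of_mem _ hxd
    · rw [hy]
      exact Finset.mem_map_of_mem _ hyd

/-- If every component of size `m` is covered pairwise by edges, there are at least
`n (m - 1) / 12` edges. -/
theorem LinearQuadSystem.le_card_edges {n m s : ℕ} (H : LinearQuadSystem n) (comp : Fin n → Fin s)
    (hm : ∀ c, (Finset.univ.filter fun p => comp p = c).card = m)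
    (hcov : ∀ p q, p ≠ q → comp p = comp q → ∃ b ∈ H.edges, p ∈ b ∧ q ∈ b) :
    n * (m - 1) ≤ 12 * H.edges.card := by
  let D : Finset (Σ _ : Fin n, Fin n) := Finset.univ.sigma fun p =>
    (Finset.univ.filter fun q => comp q = comp p).erase p
  have hD : D.card = n * (m - 1) := by
    rw [Finset.card_sigma, Finset.sum_const_nat (m := m - 1)]
    · simp
    · intro p _
      rw [Finset.card_erase_of_mem (by simp), hm]
  let f : Fin n × Fin n ↪ Σ _ : Fin n, Fin n := (Equiv.sigmaEquivProd _ _).symm.toEmbedding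
  have hsub : D ⊆ H.edges.biUnion fun b => b.offDiag.map f := by
    rintro ⟨p, q⟩ hpq
    simp only [D, Finset.mem_sigma, Finset.mem_erase, Finset.mem_filter, Finset.mem_univ,
      true_and] at hpq
    obtain ⟨b, hb, hp, hq⟩ := hcov p q (Ne.symm hpq.1) hpq.2.symm
    refine Finset.mem_biUnion.2 ⟨b, hb, Finset.mem_map.2 ⟨(p, q), ?_, rfl⟩⟩
    exact Finset.mem_offDiag.2 ⟨hp, hq, Ne.symm hpq.1⟩
  rw [← hD, mul_comm]
  refine (Finset.card_le_card hsub).trans (Finset.card_biUnion_le_card_mul _ _ _ fun b hb => ?_)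
  rw [Finset.card_map, Finset.offDiag_card, H.card_four b hb]

/-- The union of the first `j` quadruples of a linear 4-tree has `3 * j + 1` vertices, and every
function constant on quadruples is constant on it. -/
theorem IsLinear4Tree.card_and_const {k : ℕ} {e : Fin k → Finset ℕ} (hT : IsLinear4Tree k e)
    {α : Type*} (g : ℕ → α) (hg : ∀ i, ∀ x ∈ e i, ∀ y ∈ e i, g x = g y) (j : ℕ) (hj : 0 < j)
    (hjk : j ≤ k) :
    ((Finset.univ.filter fun i : Fin k => (i : ℕ) < j).biUnion e).card = 3 * j + 1 ∧
    ∀ x ∈ (Finset.univ.filter fun i : Fin k => (i : ℕ) < j).biUnion e,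
      ∀ y ∈ (Finset.univ.filter fun i : Fin k => (i : ℕ) < j).biUnion e, g x = g y := by
  induction j, hj using Nat.le_induction with
  | base =>
    have : (Finset.univ.filter fun i : Fin k => (i : ℕ) < 1) = {⟨0, hjk⟩} := by
      ext i
      simp [Fin.ext_iff]
    rw [Nat.succ_eq_add_one, Nat.zero_add, this, Finset.singleton_biUnion]
    exact ⟨hT.1 _, hg _⟩
  | succ j hj ih =>
    obtain ⟨hcard, hconst⟩ := ih (by omega)
    let i : Fin k := ⟨j, hjk⟩
    have hstep : (Finset.univ.filter fun l : Fin k => (l : ℕ) < j + 1) =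
        insert i (Finset.univ.filter fun l : Fin k => (l : ℕ) < j) := by
      ext l
      simp only [Finset.mem_filter, Finset.mem_univ, true_and, Finset.mem_insert, Fin.ext_iff, i]
      omega
    have h1 : (e i ∩ (Finset.univ.filter fun l : Fin k => (l : ℕ) < j).biUnion e).card = 1 :=
      hT.2 i hj
    rw [hstep, Finset.biUnion_insert]
    set U := (Finset.univ.filter fun l : Fin k => (l : ℕ) < j).biUnion e
    constructor
    · have := Finset.card_union_add_card_inter (e i) U
      rw [h1, hT.1, hcard] at this
      omega
    · obtain ⟨v, hv⟩ := Finset.card_eq_one.1 h1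
      have hv' : v ∈ e i ∩ U := by simp [hv]
      rw [Finset.mem_inter] at hv'
      have hgv : ∀ x ∈ e i ∪ U, g x = g v := by
        intro x hx
        rcases Finset.mem_union.1 hx with h | h
        · exact hg i x h v hv'.1
        · exact hconst x h v hv'.2
      intro x hx y hy
      rw [hgv x hx, hgv y hy]

/-- if `(3k-2) ∣ n` and `3k-2 ≡ 1, 4 (mod 12)`, then for every linear
4-tree `T` with `k` quadruples there is a `T`-free linear quadruple system on `n`
vertices with at least `n(k-1)/4` quadruples (stated as `4 · |E(H)| ≥ n(k-1)`). -/
theorem linear_turan_tree_lower (k n : ℕ) (hk : 1 ≤ k) (hn : 0 < n)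
    (hdvd : (3 * k - 2) ∣ n) (hmod : (3 * k - 2) % 12 = 1 ∨ (3 * k - 2) % 12 = 4)
    (e : Fin k → Finset ℕ) (hT : IsLinear4Tree k e) :
    ∃ H : LinearQuadSystem n, ¬ ContainsCopy e H ∧ n * (k - 1) ≤ 4 * H.edges.card := by
  obtain ⟨s, rfl⟩ := hdvd
  obtain ⟨H, comp, hconst, hcard, hcov⟩ :=
    exists_linearQuadSystem_of_hasSteiner (hasSteiner_of_mod hmod) (mul_comm s (3 * k - 2))
  refine ⟨H, ?_, ?_⟩
  · rintro ⟨φ, hinj, hφ⟩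
    have hk0 : Finset.univ.filter (fun i : Fin k => (i : ℕ) < k) = Finset.univ := by simp
    obtain ⟨hU, hUconst⟩ := hT.card_and_const (fun x => comp (φ x)) (fun i x hx y hy =>
      hconst _ (hφ i) _ (Finset.mem_image_of_mem φ hx) _ (Finset.mem_image_of_mem φ hy)) k hk le_rfl
    rw [hk0] at hU hUconst
    obtain ⟨x, hx⟩ : (Finset.univ.biUnion e).Nonempty := Finset.card_pos.1 (by omega)
    have hle := Finset.card_le_card_of_injOn (t := Finset.univ.filter fun p => comp p = comp (φ x))
      φ (fun y hy => by simpa using hUconst y hy x hx) hinj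
    rw [hU, hcard] at hle
    omega
  · have h := H.le_card_edges comp hcard hcov
    have hm : 3 * k - 2 - 1 = 3 * (k - 1) := by omega
    rw [hm, mul_left_comm] at h
    omega
end

section
/- Every P_3-free linear quadruple system on n vertices has at most n quadruples; that is, ex^lin_4(n, P_3) ≤ n. -/
/-- `H` contains the linear 4-path `P_k`: quadruples `e 0, …, e (k-1)` with consecutive
quadruples meeting in exactly one vertex and non-consecutive quadruples disjoint. -/
def ContainsPath {n : ℕ} (k : ℕ) (H : LinearQuadSystem n) : Prop :=
  ∃ e : Fin k → Finset (Fin n),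
    (∀ i, e i ∈ H.edges) ∧
    (∀ i j : Fin k, (i : ℕ) + 1 = (j : ℕ) → (e i ∩ e j).card = 1) ∧
    (∀ i j : Fin k, (i : ℕ) + 2 ≤ (j : ℕ) → e i ∩ e j = ∅)

namespace LinearQuadSystem

variable {n : ℕ} (H : LinearQuadSystem n)

/-- In a `P_3`-free linear quadruple system, meeting is a transitive relation on quadruples. -/
theorem inter_nonempty_trans (hfree : ¬ ContainsPath 3 H) {e f g : Finset (Fin n)}
    (he : e ∈ H.edges) (hf : f ∈ H.edges) (hg : g ∈ H.edges)
    (hef : (e ∩ f).Nonempty) (hfg : (f ∩ g).Nonempty) : (e ∩ g).Nonempty := by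
  by_contra hne
  rw [Finset.not_nonempty_iff_eq_empty] at hne
  have hef' : e ≠ f := by
    rintro rfl
    simp [hne] at hfg
  have hfg' : f ≠ g := by
    rintro rfl
    simp [hne] at hef
  have h₁ : (e ∩ f).card = 1 := le_antisymm (H.linear e he f hf hef') hef.card_pos
  have h₂ : (f ∩ g).card = 1 := le_antisymm (H.linear f hf g hg hfg') hfg.card_pos
  refine hfree ⟨![e, f, g], ?_, ?_, ?_⟩
  · intro i
    fin_cases i <;> simpa
  · intro i j hij
    fin_cases i <;> fin_cases j <;> simp_all
  · intro i j hij
    fin_cases i <;> fin_cases j <;> simp_all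

/-- The sizes of pairwise intersections of quadruples: `4` on the diagonal, and off the diagonal
`1` or `0` according to whether the quadruples meet. -/
theorem card_inter_eq {e f : Finset (Fin n)} (he : e ∈ H.edges) (hf : f ∈ H.edges) :
    (e ∩ f).card = (if e = f then 3 else 0) + if (e ∩ f).Nonempty then 1 else 0 := by
  by_cases hef : e = f
  · subst hef
    have hcard := H.card_four e he
    have hne : e.Nonempty := Finset.card_pos.mp (by omega)
    simp [hcard, hne]
  · by_cases hne : (e ∩ f).Nonempty
    · simp [hef, hne, le_antisymm (H.linear e he f hf hef) hne.card_pos]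
    · simp [hef, Finset.not_nonempty_iff_eq_empty.mp hne]

/-- The incidence vectors of the quadruples of a `P_3`-free linear quadruple system are linearly
independent. -/
theorem linearIndependent_incidence (hfree : ¬ ContainsPath 3 H) :
    LinearIndependent ℚ
      (fun (e : H.edges) (v : Fin n) => if v ∈ e.1 then (1 : ℚ) else 0) := by
  rw [Fintype.linearIndependent_iff]
  intro c hc
  have gram (f : H.edges) : ∑ e : H.edges, c e * ((e.1 ∩ f.1).card : ℚ) = 0 := by
    have hsum : ∑ v ∈ f.1, ∑ e : H.edges, c e * (if v ∈ e.1 then (1 : ℚ) else 0) = 0 :=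
      Finset.sum_eq_zero fun v _ => by simpa [Finset.sum_apply] using congrFun hc v
    rw [Finset.sum_comm] at hsum
    rw [← hsum]
    refine Finset.sum_congr rfl fun e _ => ?_
    rw [← Finset.mul_sum, Finset.sum_boole, Finset.filter_mem_eq_inter, Finset.inter_comm]
  have class_sum (f : H.edges) :
      3 * c f + ∑ e : H.edges with (e.1 ∩ f.1).Nonempty, c e = 0 := by
    rw [← gram f, Finset.sum_filter]
    have hterm (e : H.edges) : c e * ((e.1 ∩ f.1).card : ℚ) =
        (if e = f then 3 * c e else 0) + if (e.1 ∩ f.1).Nonempty then c e else 0 := by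
      rw [H.card_inter_eq e.2 f.2]
      simp only [Subtype.ext_iff]
      push_cast
      split_ifs <;> ring
    simp [hterm, Finset.sum_add_distrib]
  have const {e f : H.edges} (hef : (e.1 ∩ f.1).Nonempty) : c e = c f := by
    have hfilter : (Finset.univ.filter fun g : H.edges => (g.1 ∩ e.1).Nonempty) =
        Finset.univ.filter fun g : H.edges => (g.1 ∩ f.1).Nonempty := by
      ext g
      simp only [Finset.mem_filter, Finset.mem_univ, true_and]
      exact ⟨fun h => H.inter_nonempty_trans hfree g.2 e.2 f.2 h hef,
        fun h => H.inter_nonempty_trans hfree g.2 f.2 e.2 h (by rwa [Finset.inter_comm])⟩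
    have he := class_sum e
    rw [hfilter] at he
    linarith [class_sum f]
  intro f
  have hf := class_sum f
  rw [Finset.sum_congr rfl fun e he => const (Finset.mem_filter.mp he).2, Finset.sum_const,
    nsmul_eq_mul, ← add_mul] at hf
  exact (mul_eq_zero.mp hf).resolve_left (by positivity)

end LinearQuadSystem

/-- every `P_3`-free linear quadruple system on `n` vertices has at most
`n` quadruples. -/
theorem linear_turan_P3_upper (n : ℕ) (H : LinearQuadSystem n)
    (hfree : ¬ ContainsPath 3 H) : H.edges.card ≤ n := by
  simpa using (H.linearIndependent_incidence hfree).fintype_card_le_finrank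
end

section
/- Every S_3^+-free linear quadruple system on n vertices has at most 5n/4 quadruples; that is, ex^lin_4(n, S_3^+) ≤ 5n/4. -/
/-- `H` contains `S_3^+`: a linear 4-star with three quadruples `e₁, e₂, e₃` through a
common center `p` (pairwise meeting exactly in `p`), together with a fourth quadruple
`f` meeting `e₁` in exactly one vertex `q ≠ p` and disjoint from `e₂` and `e₃`. -/
def ContainsS3plus {n : ℕ} (H : LinearQuadSystem n) : Prop :=
  ∃ p : Fin n, ∃ e₁ e₂ e₃ f : Finset (Fin n),
    e₁ ∈ H.edges ∧ e₂ ∈ H.edges ∧ e₃ ∈ H.edges ∧ f ∈ H.edges ∧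
    e₁ ∩ e₂ = {p} ∧ e₁ ∩ e₃ = {p} ∧ e₂ ∩ e₃ = {p} ∧
    ∃ q : Fin n, q ≠ p ∧ f ∩ e₁ = {q} ∧ f ∩ e₂ = ∅ ∧ f ∩ e₃ = ∅

namespace LinearQuadSystem

variable {n : ℕ} (H : LinearQuadSystem n)

/-- The edges of `H` through the vertex `v`. -/
def star (v : Fin n) : Finset (Finset (Fin n)) := H.edges.filter (v ∈ ·)

variable {H}

theorem mem_star {v : Fin n} {e : Finset (Fin n)} : e ∈ H.star v ↔ e ∈ H.edges ∧ v ∈ e :=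
  Finset.mem_filter

theorem edge_eq_of_mem {e f : Finset (Fin n)} (he : e ∈ H.edges) (hf : f ∈ H.edges)
    {x y : Fin n} (hxy : x ≠ y) (hxe : x ∈ e) (hxf : x ∈ f) (hye : y ∈ e) (hyf : y ∈ f) :
    e = f := by
  by_contra h
  exact hxy (Finset.card_le_one.1 (H.linear e he f hf h) x (Finset.mem_inter.2 ⟨hxe, hxf⟩)
    y (Finset.mem_inter.2 ⟨hye, hyf⟩))

theorem inter_eq_singleton {e f : Finset (Fin n)} (he : e ∈ H.edges) (hf : f ∈ H.edges)
    (hne : e ≠ f) {x : Fin n} (hxe : x ∈ e) (hxf : x ∈ f) : e ∩ f = {x} := by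
  ext y
  rw [Finset.mem_inter, Finset.mem_singleton]
  refine ⟨fun h => ?_, fun h => h ▸ ⟨hxe, hxf⟩⟩
  by_contra hyx
  exact hne (edge_eq_of_mem he hf hyx h.1 h.2 hxe hxf)

/-- At most four edges through `p` meet an edge that avoids `p`. -/
theorem card_star_meeting_le {p : Fin n} {f : Finset (Fin n)} (hf : f ∈ H.edges) (hpf : p ∉ f) :
    ((H.star p).filter fun g => ¬ f ∩ g = ∅).card ≤ 4 := by
  have hsub : ((H.star p).filter fun g => ¬ f ∩ g = ∅) ⊆
      f.biUnion fun x => (H.star p).filter (x ∈ ·) := by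
    intro g hg
    obtain ⟨hg, hne⟩ := Finset.mem_filter.1 hg
    obtain ⟨x, hx⟩ := Finset.nonempty_iff_ne_empty.2 hne
    obtain ⟨hxf, hxg⟩ := Finset.mem_inter.1 hx
    exact Finset.mem_biUnion.2 ⟨x, hxf, Finset.mem_filter.2 ⟨hg, hxg⟩⟩
  refine (Finset.card_le_card hsub).trans ?_
  have hle := Finset.card_biUnion_le_card_mul f (fun x => (H.star p).filter (x ∈ ·)) 1 ?_
  · rwa [H.card_four f hf, mul_one] at hle
  · intro x hx
    refine Finset.card_le_one.2 fun g hg h hh => ?_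
    simp only [Finset.mem_filter, mem_star] at hg hh
    exact edge_eq_of_mem hg.1.1 hh.1.1 (ne_of_mem_of_not_mem hx hpf) hg.2 hh.2 hg.1.2 hh.1.2

/-- In an `S_3^+`-free system, a neighbour of a vertex of degree at least six lies on
only one edge. -/
theorem eq_of_six_le_card_star (hfree : ¬ ContainsS3plus H) {p q : Fin n}
    {e f : Finset (Fin n)} (hp : 6 ≤ (H.star p).card) (he : e ∈ H.edges) (hpe : p ∈ e)
    (hqe : q ∈ e) (hqp : q ≠ p) (hf : f ∈ H.edges) (hqf : q ∈ f) : f = e := by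
  by_contra hfe
  have hpf : p ∉ f := fun hpf => hfe (edge_eq_of_mem hf he hqp hqf hqe hpf hpe)
  have hmeet := card_star_meeting_le hf hpf
  have hsplit := Finset.card_filter_add_card_filter_not (s := H.star p) (fun g => f ∩ g = ∅)
  obtain ⟨g, hg, h, hh, hgh⟩ := Finset.one_lt_card.1
    (show 1 < ((H.star p).filter fun g => f ∩ g = ∅).card by omega)
  simp only [Finset.mem_filter, mem_star] at hg hh
  have hne : ∀ k, f ∩ k = ∅ → e ≠ k := by
    rintro k hk rfl
    exact Finset.notMem_empty q (hk ▸ Finset.mem_inter.2 ⟨hqf, hqe⟩)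
  exact hfree ⟨p, e, g, h, f, he, hg.1.1, hh.1.1, hf,
    inter_eq_singleton he hg.1.1 (hne g hg.2) hpe hg.1.2,
    inter_eq_singleton he hh.1.1 (hne h hh.2) hpe hh.1.2,
    inter_eq_singleton hg.1.1 hh.1.1 hgh hg.1.2 hh.1.2,
    q, hqp, inter_eq_singleton hf he hfe hqf hqe, hg.2, hh.2⟩

/-- In an `S_3^+`-free system, the inverse degrees along an edge sum to at least `4 / 5`. -/
theorem four_fifths_le_sum_inv_card_star (hfree : ¬ ContainsS3plus H) {e : Finset (Fin n)}
    (he : e ∈ H.edges) : (4 / 5 : ℚ) ≤ ∑ v ∈ e, ((H.star v).card : ℚ)⁻¹ := by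
  by_cases hbig : ∃ p ∈ e, 6 ≤ (H.star p).card
  · obtain ⟨p, hpe, hp⟩ := hbig
    have hone : ∀ v ∈ e.erase p, ((H.star v).card : ℚ)⁻¹ = 1 := by
      intro v hv
      obtain ⟨hvp, hve⟩ := Finset.mem_erase.1 hv
      have hstar : H.star v = {e} := by
        ext f
        rw [mem_star, Finset.mem_singleton]
        exact ⟨fun hf => eq_of_six_le_card_star hfree hp he hpe hve hvp hf.1 hf.2,
          fun hf => hf ▸ ⟨he, hve⟩⟩
      simp [hstar]
    rw [← Finset.add_sum_erase e _ hpe, Finset.sum_congr rfl hone, Finset.sum_const,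
      Finset.card_erase_of_mem hpe, H.card_four e he]
    have : (0 : ℚ) ≤ ((H.star p).card : ℚ)⁻¹ := by positivity
    norm_num
    linarith
  · push Not at hbig
    have hle : ∀ v ∈ e, (1 / 5 : ℚ) ≤ ((H.star v).card : ℚ)⁻¹ := by
      intro v hv
      have hpos : 0 < (H.star v).card := Finset.card_pos.2 ⟨e, mem_star.2 ⟨he, hv⟩⟩
      rw [one_div]
      refine inv_anti₀ (by exact_mod_cast hpos) ?_
      exact_mod_cast Nat.le_of_lt_succ (hbig v hv)
    have hsum := Finset.card_nsmul_le_sum e _ _ hle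
    rw [H.card_four e he] at hsum
    norm_num at hsum ⊢
    exact hsum

variable (H) in
theorem sum_edges_sum_inv_card_star_le :
    ∑ e ∈ H.edges, ∑ v ∈ e, ((H.star v).card : ℚ)⁻¹ ≤ n := by
  rw [Finset.sum_comm' (t' := Finset.univ) (s' := H.star)
    (by simp [mem_star])]
  calc ∑ v, ∑ _e ∈ H.star v, ((H.star v).card : ℚ)⁻¹ ≤ ∑ _v : Fin n, (1 : ℚ) := by
        refine Finset.sum_le_sum fun v _ => ?_
        rw [Finset.sum_const, nsmul_eq_mul]
        exact mul_inv_le_one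
    _ = n := by simp

end LinearQuadSystem

/-- every `S_3^+`-free linear quadruple system on `n` vertices has at most
`5n/4` quadruples (stated as `4 · |E(H)| ≤ 5n`). -/
theorem linear_turan_S3plus_upper (n : ℕ) (H : LinearQuadSystem n)
    (hfree : ¬ ContainsS3plus H) : 4 * H.edges.card ≤ 5 * n := by
  have hlow := Finset.card_nsmul_le_sum H.edges _ _
    fun e he => LinearQuadSystem.four_fifths_le_sum_inv_card_star hfree he
  have hup := hlow.trans H.sum_edges_sum_inv_card_star_le
  rw [nsmul_eq_mul] at hup
  have hq : (4 * H.edges.card : ℚ) ≤ 5 * n := by linarith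
  exact_mod_cast hq
end

section
/- Every P_4-free linear quadruple system on n vertices has at most 5n/4 quadruples; that is, ex^lin_4(n, P_4) ≤ 5n/4. -/
open Finset

variable {α : Type*} [DecidableEq α]

/-- A finite linear 4-uniform family without a linear 4-path. -/
structure IsLinearP4Free (E : Finset (Finset α)) : Prop where
  card_four : ∀ e ∈ E, e.card = 4
  linear : ∀ e ∈ E, ∀ f ∈ E, e ≠ f → (e ∩ f).card ≤ 1
  free : ∀ a ∈ E, ∀ b ∈ E, ∀ c ∈ E, ∀ d ∈ E, (a ∩ b).card = 1 → (b ∩ c).card = 1 →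
    (c ∩ d).card = 1 → Disjoint a c → Disjoint a d → Disjoint b d → False

namespace IsLinearP4Free

/-- The edges through `v`. -/
def star (E : Finset (Finset α)) (v : α) : Finset (Finset α) := E.filter (v ∈ ·)

/-- The members of `S` that meet `f`. -/
def hit (S : Finset (Finset α)) (f : Finset α) : Finset (Finset α) :=
  S.filter (fun e => ¬ Disjoint e f)

variable {E : Finset (Finset α)} {v : α} {e f g : Finset α}

theorem mem_star : e ∈ star E v ↔ e ∈ E ∧ v ∈ e := by simp [star]

theorem mem_hit {S : Finset (Finset α)} :
    e ∈ hit S f ↔ e ∈ S ∧ ¬ Disjoint e f := by simp [hit]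

theorem hit_subset {S : Finset (Finset α)} : hit S f ⊆ S := filter_subset _ _

theorem mono (h : IsLinearP4Free E) {F : Finset (Finset α)} (hF : F ⊆ E) :
    IsLinearP4Free F where
  card_four e he := h.card_four e (hF he)
  linear e he f hf := h.linear e (hF he) f (hF hf)
  free a ha b hb c hc d hd := h.free a (hF ha) b (hF hb) c (hF hc) d (hF hd)

theorem eq_of_mem (h : IsLinearP4Free E) (he : e ∈ E) (hf : f ∈ E) (hef : e ≠ f) {x y : α}
    (hxe : x ∈ e) (hxf : x ∈ f) (hye : y ∈ e) (hyf : y ∈ f) : x = y :=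
  card_le_one.1 (h.linear e he f hf hef) x (mem_inter.2 ⟨hxe, hxf⟩) y (mem_inter.2 ⟨hye, hyf⟩)

theorem card_inter (h : IsLinearP4Free E) (he : e ∈ E) (hf : f ∈ E) (hef : e ≠ f)
    (hd : ¬ Disjoint e f) : (e ∩ f).card = 1 := by
  have h1 := h.linear e he f hf hef
  have h2 : 0 < (e ∩ f).card := card_pos.2 (not_disjoint_iff_nonempty_inter.1 hd)
  omega

theorem ne_of_mem_star (he : e ∈ star E v) (hvf : v ∉ f) : e ≠ f := by
  rintro rfl
  exact hvf (mem_star.1 he).2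

theorem subset_or_union_of_not_disjoint (h : IsLinearP4Free E) (hf : f ∈ E) (hvf : v ∉ f)
    (hg : g ∈ E) (hfg : f ≠ g) (hd : ¬ Disjoint f g) :
    hit (star E v) f ⊆ hit (star E v) g ∨
      star E v ⊆ hit (star E v) f ∪ hit (star E v) g := by
  by_contra! hcon
  obtain ⟨h1, h2⟩ := hcon
  obtain ⟨k, hkf, hkg⟩ := not_subset.1 h1
  obtain ⟨j, hj, hj'⟩ := not_subset.1 h2
  have hk := (mem_hit.1 hkf).1
  simp only [mem_union, mem_hit, hj, true_and, not_or, not_not] at hj'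
  simp only [mem_hit, hk, true_and, not_not] at hkf hkg
  have hjk : j ≠ k := by
    rintro rfl
    exact hkf hj'.1
  obtain ⟨hjE, hvj⟩ := mem_star.1 hj
  obtain ⟨hkE, hvk⟩ := mem_star.1 hk
  exact h.free j hjE k hkE f hf g hg
    (h.card_inter hjE hkE hjk (not_disjoint_iff.2 ⟨v, hvj, hvk⟩))
    (h.card_inter hkE hf (ne_of_mem_star hk hvf) hkf)
    (h.card_inter hf hg hfg hd) hj'.1 hj'.2 hkg

theorem eq_or_union_of_not_disjoint (h : IsLinearP4Free E) (hf : f ∈ E) (hvf : v ∉ f)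
    (hg : g ∈ E) (hvg : v ∉ g) (hfg : f ≠ g) (hd : ¬ Disjoint f g) :
    hit (star E v) f = hit (star E v) g ∨
      star E v ⊆ hit (star E v) f ∪ hit (star E v) g := by
  rcases h.subset_or_union_of_not_disjoint hf hvf hg hfg hd with h1 | h1
  · rcases h.subset_or_union_of_not_disjoint hg hvg hf hfg.symm
      (fun hh => hd hh.symm) with h2 | h2
    · exact .inl (h1.antisymm h2)
    · exact .inr (by rwa [union_comm])
  · exact .inr h1

theorem comparable_of_disjoint (h : IsLinearP4Free E) (hf : f ∈ E) (hvf : v ∉ f)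
    (hg : g ∈ E) (hvg : v ∉ g) (hd : Disjoint f g) :
    hit (star E v) f ⊆ hit (star E v) g ∨ hit (star E v) g ⊆ hit (star E v) f := by
  by_contra! hcon
  obtain ⟨h1, h2⟩ := hcon
  obtain ⟨i, hif, hig⟩ := not_subset.1 h1
  obtain ⟨j, hjg, hjf⟩ := not_subset.1 h2
  have hi := (mem_hit.1 hif).1
  have hj := (mem_hit.1 hjg).1
  simp only [mem_hit, hi, hj, true_and, not_not] at hif hig hjg hjf
  have hij : i ≠ j := by
    rintro rfl
    exact hif hjf
  obtain ⟨hiE, hvi⟩ := mem_star.1 hi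
  obtain ⟨hjE, hvj⟩ := mem_star.1 hj
  exact h.free f hf i hiE j hjE g hg
    (h.card_inter hf hiE (ne_of_mem_star hi hvf).symm (fun hh => hif hh.symm))
    (h.card_inter hiE hjE hij (not_disjoint_iff.2 ⟨v, hvi, hvj⟩))
    (h.card_inter hjE hg (ne_of_mem_star hj hvg) hjg) hjf.symm hd hig

theorem card_biUnion_star (h : IsLinearP4Free E) (hS : (star E v).Nonempty) :
    ((star E v).biUnion id).card = 3 * (star E v).card + 1 := by
  have h1 : (star E v).biUnion id = insert v ((star E v).biUnion (fun e => e.erase v)) := by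
    ext x
    obtain ⟨e, he⟩ := hS
    by_cases hx : x = v
    · subst hx
      simpa using ⟨e, he, (mem_star.1 he).2⟩
    · simp [hx]
  rw [h1, card_insert_of_notMem (by simp), card_biUnion]
  · rw [sum_congr rfl (g := fun _ => 3), sum_const, smul_eq_mul, mul_comm]
    intro e he
    rw [card_erase_of_mem (mem_star.1 he).2, h.card_four e (mem_star.1 he).1]
  · intro e he f hf hef
    refine disjoint_left.2 fun x hxe hxf => ?_
    exact (mem_erase.1 hxe).1 (h.eq_of_mem (mem_star.1 he).1 (mem_star.1 hf).1 hef
      (mem_erase.1 hxe).2 (mem_erase.1 hxf).2 (mem_star.1 he).2 (mem_star.1 hf).2)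

theorem card_hit (h : IsLinearP4Free E) (hf : f ∈ E) (hvf : v ∉ f) :
    (hit (star E v) f).card + (f \ (star E v).biUnion id).card = 4 := by
  have h1 : f ∩ (star E v).biUnion id = (hit (star E v) f).biUnion (fun e => e ∩ f) := by
    ext x
    simp only [mem_inter, mem_biUnion, id, mem_hit, not_disjoint_iff]
    constructor
    · rintro ⟨hx, e, he, hxe⟩
      exact ⟨e, ⟨he, x, hxe, hx⟩, hxe, hx⟩
    · rintro ⟨e, ⟨he, -⟩, hxe, hx⟩
      exact ⟨hx, e, he, hxe⟩
  have h2 : (f ∩ (star E v).biUnion id).card = (hit (star E v) f).card := by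
    rw [h1, card_biUnion]
    · rw [sum_congr rfl (g := fun _ => 1), sum_const, smul_eq_mul, mul_one]
      intro e he
      obtain ⟨he, hd⟩ := mem_hit.1 he
      exact h.card_inter (mem_star.1 he).1 hf (ne_of_mem_star he hvf) hd
    · intro e he e' he' hee
      have he := mem_star.1 (mem_hit.1 he).1
      have he' := mem_star.1 (mem_hit.1 he').1
      refine disjoint_left.2 fun x hx hx' => ?_
      have := h.eq_of_mem he.1 he'.1 hee (mem_inter.1 hx).1 (mem_inter.1 hx').1 he.2 he'.2
      exact hvf (this ▸ (mem_inter.1 hx).2)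
  rw [← h2, card_inter_add_card_sdiff, h.card_four f hf]

theorem card_le_three (h : IsLinearP4Free E) {T : Finset (Finset α)} {y : α}
    (he : e ∈ star E v) (hy : y ∉ e)
    (hT : ∀ f ∈ T, f ∈ E ∧ v ∉ f ∧ y ∈ f ∧ ¬ Disjoint e f) : T.card ≤ 3 := by
  have hp : ∀ f ∈ T, ∃ x, x ∈ e ∧ x ∈ f := fun f hf => not_disjoint_iff.1 (hT f hf).2.2.2
  have : Nonempty α := ⟨y⟩
  choose! p hpe hpf using hp
  have h3 : (e.erase v).card = 3 := by
    rw [card_erase_of_mem (mem_star.1 he).2, h.card_four e (mem_star.1 he).1]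
  rw [← h3]
  refine card_le_card_of_injOn p (fun f hf => ?_) (fun f hf g hg hfg => ?_)
  · exact mem_erase.2 ⟨fun hh => (hT f hf).2.1 (hh ▸ hpf f hf), hpe f hf⟩
  · by_contra hne
    have := h.eq_of_mem (hT f hf).1 (hT g hg).1 hne (hpf f hf) (hfg ▸ hpf g hg)
      (hT f hf).2.2.1 (hT g hg).2.2.1
    exact hy (this ▸ hpe f hf)

theorem card_le_nine (h : IsLinearP4Free E) {T I : Finset (Finset α)}
    (hI : I ⊆ star E v) (hI2 : 2 ≤ I.card)
    (hT : ∀ f ∈ T, f ∈ E ∧ v ∉ f ∧ I ⊆ hit (star E v) f) : T.card ≤ 9 := by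
  obtain ⟨e, he, e', he', hne⟩ := one_lt_card.1 hI2
  obtain ⟨heE, hve⟩ := mem_star.1 (hI he)
  obtain ⟨heE', hve'⟩ := mem_star.1 (hI he')
  have hsub : T ⊆ (e.erase v).biUnion (fun x => T.filter (x ∈ ·)) := by
    intro f hf
    obtain ⟨x, hxe, hxf⟩ := not_disjoint_iff.1 (mem_hit.1 ((hT f hf).2.2 he)).2
    refine mem_biUnion.2 ⟨x, mem_erase.2 ⟨?_, hxe⟩, mem_filter.2 ⟨hf, hxf⟩⟩
    rintro rfl
    exact (hT f hf).2.1 hxf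
  refine (card_le_card hsub).trans ((card_biUnion_le_card_mul _ _ 3 fun x hx => ?_).trans ?_)
  · refine h.card_le_three (hI he') (y := x) (fun hx' => ?_) fun f hf => ?_
    · exact (mem_erase.1 hx).1 (h.eq_of_mem heE heE' hne (mem_erase.1 hx).2 hx' hve hve')
    · obtain ⟨hf, hxf⟩ := mem_filter.1 hf
      exact ⟨(hT f hf).1, (hT f hf).2.1, hxf, (mem_hit.1 ((hT f hf).2.2 he')).2⟩
  · rw [card_erase_of_mem hve, h.card_four e heE]

/-- Edges meeting exactly one edge of a large star are at most as many as the vertices they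
cover outside the star. -/
theorem card_le_of_card_hit_eq_one (h : IsLinearP4Free E) (hd : 6 ≤ (star E v).card)
    {T : Finset (Finset α)} {B : Finset α}
    (hT : ∀ f ∈ T, f ∈ E ∧ v ∉ f ∧ (hit (star E v) f).card = 1)
    (hB : ∀ f ∈ T, f \ (star E v).biUnion id ⊆ B)
    (hBU : Disjoint B ((star E v).biUnion id)) : T.card ≤ B.card := by
  have key : T.card * 3 ≤ B.card * 3 := by
    refine card_mul_le_card_mul (fun (f : Finset α) (y : α) => y ∈ f) (fun f hf => ?_)
      (fun y hy => ?_)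
    · have h1 := h.card_hit (hT f hf).1 (hT f hf).2.1
      have h2 : f \ (star E v).biUnion id ⊆ B.bipartiteAbove (fun f y => y ∈ f) f := by
        intro y hy
        simp only [bipartiteAbove, mem_filter]
        exact ⟨hB f hf hy, (mem_sdiff.1 hy).1⟩
      have := card_le_card h2
      have := (hT f hf).2.2
      omega
    · rcases (T.bipartiteBelow (fun f y => y ∈ f) y).eq_empty_or_nonempty with h0 | ⟨f, hf⟩
      · simp [h0]
      simp only [bipartiteBelow, mem_filter] at hf
      obtain ⟨hfT, hyf⟩ := hf
      obtain ⟨hfE, hvf, hf1⟩ := hT f hfT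
      obtain ⟨e, he⟩ := card_eq_one.1 hf1
      have heS : e ∈ star E v := (mem_hit.1 (he ▸ mem_singleton_self e : e ∈ hit _ f)).1
      refine h.card_le_three heS (y := y) (fun hye => ?_) fun g hg => ?_
      · exact disjoint_left.1 hBU hy (mem_biUnion.2 ⟨e, heS, hye⟩)
      · simp only [bipartiteBelow, mem_filter] at hg
        obtain ⟨hgT, hyg⟩ := hg
        obtain ⟨hgE, hvg, hg1⟩ := hT g hgT
        refine ⟨hgE, hvg, hyg, ?_⟩
        suffices hh : hit (star E v) f = hit (star E v) g from
          (mem_hit.1 (hh ▸ he ▸ mem_singleton_self e : e ∈ hit (star E v) g)).2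
        by_cases hfg : f = g
        · rw [hfg]
        rcases h.eq_or_union_of_not_disjoint hfE hvf hgE hvg hfg
          (not_disjoint_iff.2 ⟨y, hyf, hyg⟩) with h1 | h1
        · exact h1
        · have := (card_le_card h1).trans (card_union_le _ _)
          omega
  omega

/-- Edges meeting at least two edges of a large star: at most `18`, and at most `17` when all
of them are covered by the star. -/
theorem card_le_of_two_le_card_hit (h : IsLinearP4Free E) (hd : 6 ≤ (star E v).card)
    {T : Finset (Finset α)}
    (hT : ∀ f ∈ T, f ∈ E ∧ v ∉ f ∧ 2 ≤ (hit (star E v) f).card) :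
    T.card ≤ 17 ∨ T.card ≤ 18 ∧ ∃ f ∈ T, (f \ (star E v).biUnion id).Nonempty := by
  rcases T.eq_empty_or_nonempty with rfl | hne
  · simp
  obtain ⟨f, hfT, hmin⟩ := exists_min_image T (fun f => (hit (star E v) f).card) hne
  obtain ⟨hfE, hvf, hf2⟩ := hT f hfT
  have h4 : ∀ g ∈ T, (hit (star E v) g).card + (g \ (star E v).biUnion id).card = 4 :=
    fun g hg => h.card_hit (hT g hg).1 (hT g hg).2.1
  have hcomp : ∀ g ∈ T, ∀ g' ∈ T, ¬ hit (star E v) g ⊆ hit (star E v) g' →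
      (hit (star E v) g).card ≤ (hit (star E v) g').card →
      ¬ Disjoint g g' ∧ star E v ⊆ hit (star E v) g ∪ hit (star E v) g' := by
    intro g hg g' hg' hnot hle
    have hnot' : ¬ hit (star E v) g' ⊆ hit (star E v) g := fun hh =>
      hnot (eq_of_subset_of_card_le hh hle).ge
    have hgg : g ≠ g' := by
      rintro rfl
      exact hnot subset_rfl
    have hdis : ¬ Disjoint g g' := fun hh =>
      (h.comparable_of_disjoint (hT g hg).1 (hT g hg).2.1 (hT g' hg').1 (hT g' hg').2.1 hh).elim
        hnot hnot'
    exact ⟨hdis, (h.subset_or_union_of_not_disjoint (hT g hg).1 (hT g hg).2.1 (hT g' hg').1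
      hgg hdis).resolve_left hnot⟩
  set P := T.filter (fun g => hit (star E v) f ⊆ hit (star E v) g) with hP
  set Q := T.filter (fun g => ¬ hit (star E v) f ⊆ hit (star E v) g) with hQ
  have hPQ : P.card + Q.card = T.card := card_filter_add_card_filter_not _
  have hP9 : P.card ≤ 9 := h.card_le_nine hit_subset hf2 fun g hg =>
    ⟨(hT g (mem_filter.1 hg).1).1, (hT g (mem_filter.1 hg).1).2.1, (mem_filter.1 hg).2⟩
  have hQ9 : Q.card ≤ 9 := by
    refine h.card_le_nine (I := star E v \ hit (star E v) f) sdiff_subset ?_ fun g hg => ?_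
    · rw [card_sdiff_of_subset hit_subset]
      have := h4 f hfT
      omega
    · obtain ⟨hg, hnot⟩ := mem_filter.1 hg
      exact ⟨(hT g hg).1, (hT g hg).2.1,
        sdiff_le_iff.2 (hcomp f hfT g hg hnot (hmin g hg)).2⟩
  by_cases hB : ∃ f ∈ T, (f \ (star E v).biUnion id).Nonempty
  · exact .inr ⟨by omega, hB⟩
  left
  have h0 : ∀ g ∈ T, g \ (star E v).biUnion id = ∅ := fun g hg =>
    not_nonempty_iff_eq_empty.1 fun hh => hB ⟨g, hg, hh⟩
  have hc : ∀ g ∈ T, (hit (star E v) g).card = 4 := fun g hg => by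
    simpa [h0 g hg] using h4 g hg
  rcases Q.eq_empty_or_nonempty with hQ0 | ⟨g, hg⟩
  · simp only [hQ0, card_empty] at hPQ
    omega
  obtain ⟨hgT, hnot⟩ := mem_filter.1 hg
  have hcup := (hcomp f hfT g hgT hnot (hmin g hgT)).2
  have hcap : (hit (star E v) f ∩ hit (star E v) g).card ≤ 2 := by
    have h1 := card_union_add_card_inter (hit (star E v) f) (hit (star E v) g)
    have h2 := card_le_card hcup
    have h3 := hc f hfT
    have h4 := hc g hgT
    omega
  have hPsub : P ⊆ (hit (star E v) f ∩ hit (star E v) g).biUnion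
      (fun e => P.filter (fun f' => ∃ x ∈ e, x ∈ f' ∧ x ∈ g)) := by
    intro f' hf'
    obtain ⟨hf'T, hsub⟩ := mem_filter.1 hf'
    have heq : hit (star E v) f = hit (star E v) f' :=
      eq_of_subset_of_card_le hsub (by rw [hc f hfT, hc f' hf'T])
    obtain ⟨x, hxf, hxg⟩ := not_disjoint_iff.1 (hcomp f' hf'T g hgT (heq ▸ hnot)
      (by rw [hc g hgT, hc f' hf'T])).1
    obtain ⟨e, he, hxe⟩ := mem_biUnion.1 (sdiff_eq_empty_iff_subset.1 (h0 f' hf'T) hxf)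
    refine mem_biUnion.2 ⟨e, mem_inter.2 ⟨heq ▸ mem_hit.2 ⟨he, ?_⟩, mem_hit.2 ⟨he, ?_⟩⟩,
      mem_filter.2 ⟨hf', x, hxe, hxf, hxg⟩⟩
    · exact not_disjoint_iff.2 ⟨x, hxe, hxf⟩
    · exact not_disjoint_iff.2 ⟨x, hxe, hxg⟩
  have hP6 : P.card ≤ 2 * 3 := by
    refine (card_le_card hPsub).trans ((card_biUnion_le_card_mul _ _ 3 fun e he => ?_).trans
      (Nat.mul_le_mul_right 3 hcap))
    obtain ⟨hef, heg⟩ := mem_inter.1 he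
    obtain ⟨heS, hd⟩ := mem_hit.1 heg
    obtain ⟨x, hxe, hxg⟩ := not_disjoint_iff.1 hd
    obtain ⟨e', he', hee⟩ := exists_mem_ne hf2 e
    obtain ⟨heE, hve⟩ := mem_star.1 heS
    obtain ⟨heE', hve'⟩ := mem_star.1 (mem_hit.1 he').1
    refine h.card_le_three (mem_hit.1 he').1 (y := x) (fun hx => ?_) fun f' hf' => ?_
    · exact (hT g hgT).2.1 (h.eq_of_mem heE heE' hee.symm hxe hx hve hve' ▸ hxg)
    · obtain ⟨hf', z, hze, hzf, hzg⟩ := mem_filter.1 hf'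
      obtain ⟨hf'T, hsub⟩ := mem_filter.1 hf'
      refine ⟨(hT f' hf'T).1, (hT f' hf'T).2.1, ?_, (mem_hit.1 (hsub he')).2⟩
      rwa [h.eq_of_mem heE (hT g hgT).1 (ne_of_mem_star heS (hT g hgT).2.1) hxe hxg hze hzg]
  omega

/-- The edges in the component of a vertex of degree at least six. -/
theorem card_le_of_hit_nonempty (h : IsLinearP4Free E) (hd : 6 ≤ (star E v).card) :
    4 * (E.filter (fun f => (hit (star E v) f).Nonempty)).card ≤
      5 * ((E.filter (fun f => (hit (star E v) f).Nonempty)).biUnion id).card := by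
  set C := E.filter (fun f => (hit (star E v) f).Nonempty) with hC
  set U := (star E v).biUnion id with hU
  set N := C.filter (v ∉ ·) with hN
  set B := C.biUnion id \ U with hB
  have hSC : star E v = C.filter (v ∈ ·) := by
    ext e
    simp only [hC, mem_filter, mem_star]
    constructor
    · rintro ⟨he, hv⟩
      exact ⟨⟨he, e, mem_hit.2 ⟨mem_star.2 ⟨he, hv⟩, not_disjoint_iff.2 ⟨v, hv, hv⟩⟩⟩, hv⟩
    · rintro ⟨⟨he, -⟩, hv⟩
      exact ⟨he, hv⟩
  have hUC : U ⊆ C.biUnion id := biUnion_subset_biUnion_of_subset_left _ <| by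
    rw [hSC]
    exact filter_subset _ _
  have hUcard : U.card = 3 * (star E v).card + 1 :=
    h.card_biUnion_star (card_pos.1 (by omega))
  have hBcard : B.card + U.card = (C.biUnion id).card := card_sdiff_add_card_eq_card hUC
  have hCcard : (star E v).card + N.card = C.card := by
    rw [hSC]
    exact card_filter_add_card_filter_not _
  have hNE : ∀ f ∈ N, f ∈ E ∧ v ∉ f ∧ (hit (star E v) f).Nonempty ∧ f \ U ⊆ B := by
    intro f hf
    obtain ⟨hfC, hvf⟩ := mem_filter.1 hf
    obtain ⟨hfE, hne⟩ := mem_filter.1 hfC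
    exact ⟨hfE, hvf, hne, sdiff_subset_sdiff (subset_biUnion_of_mem id hfC) subset_rfl⟩
  have hN12 : (N.filter (fun f => (hit (star E v) f).card = 1)).card +
      (N.filter (fun f => ¬ (hit (star E v) f).card = 1)).card = N.card :=
    card_filter_add_card_filter_not _
  have h1 : (N.filter (fun f => (hit (star E v) f).card = 1)).card ≤ B.card := by
    refine h.card_le_of_card_hit_eq_one hd (fun f hf => ?_) (fun f hf => ?_) sdiff_disjoint
    · obtain ⟨hf, hc⟩ := mem_filter.1 hf
      exact ⟨(hNE f hf).1, (hNE f hf).2.1, hc⟩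
    · exact (hNE f (mem_filter.1 hf).1).2.2.2
  have h2 := h.card_le_of_two_le_card_hit hd
    (T := N.filter (fun f => ¬ (hit (star E v) f).card = 1)) fun f hf => by
      obtain ⟨hf, hc⟩ := mem_filter.1 hf
      have := card_pos.2 (hNE f hf).2.2.1
      exact ⟨(hNE f hf).1, (hNE f hf).2.1, by omega⟩
  rcases h2 with h2 | ⟨h2, f, hf, hne⟩
  · omega
  · have := card_pos.2 (hne.mono (hNE f (mem_filter.1 hf).1).2.2.2)
    omega

theorem disjoint_biUnion_hit (h : IsLinearP4Free E) (hd : 6 ≤ (star E v).card) :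
    Disjoint ((E.filter (fun f => (hit (star E v) f).Nonempty)).biUnion id)
      ((E.filter (fun f => ¬ (hit (star E v) f).Nonempty)).biUnion id) := by
  simp only [disjoint_biUnion_left, disjoint_biUnion_right, mem_filter, id]
  rintro g ⟨hg, hg0⟩ f ⟨hf, hfn⟩
  rw [not_nonempty_iff_eq_empty] at hg0
  by_contra hdis
  have hvg : v ∉ g := fun hv => notMem_empty g <| hg0 ▸
    mem_hit.2 ⟨mem_star.2 ⟨hg, hv⟩, not_disjoint_iff.2 ⟨v, hv, hv⟩⟩
  have hvf : v ∉ f := fun hv => notMem_empty f <| hg0 ▸ mem_hit.2 ⟨mem_star.2 ⟨hf, hv⟩, hdis⟩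
  have hfg : f ≠ g := by
    rintro rfl
    simp [hg0] at hfn
  rcases h.subset_or_union_of_not_disjoint hf hvf hg hfg hdis with h1 | h1
  · rw [hg0, subset_empty] at h1
    simp [h1] at hfn
  · rw [hg0, union_empty] at h1
    have := card_le_card h1
    have := h.card_hit hf hvf
    omega

theorem four_mul_card_le (h : IsLinearP4Free E) : 4 * E.card ≤ 5 * (E.biUnion id).card := by
  induction hk : E.card using Nat.strong_induction_on generalizing E with
  | _ k ih =>
  subst hk
  by_cases hdeg : ∃ v, 6 ≤ (star E v).card
  · obtain ⟨v, hd⟩ := hdeg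
    have hcard : (E.filter (fun f => (hit (star E v) f).Nonempty)).card +
        (E.filter (fun f => ¬ (hit (star E v) f).Nonempty)).card = E.card :=
      card_filter_add_card_filter_not _
    have h1 := h.card_le_of_hit_nonempty hd
    have hpos : 0 < (E.filter (fun f => (hit (star E v) f).Nonempty)).card := by
      obtain ⟨e, he⟩ : (star E v).Nonempty := card_pos.1 (by omega)
      obtain ⟨heE, hve⟩ := mem_star.1 he
      exact card_pos.2 ⟨e, mem_filter.2
        ⟨heE, e, mem_hit.2 ⟨he, not_disjoint_iff.2 ⟨v, hve, hve⟩⟩⟩⟩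
    have h2 := ih _ (by omega) (h.mono (filter_subset (fun f => ¬ (hit (star E v) f).Nonempty) E)) rfl
    have h3 := card_union_of_disjoint (h.disjoint_biUnion_hit hd)
    rw [← union_biUnion, filter_union_filter_not_eq] at h3
    omega
  · push Not at hdeg
    rw [mul_comm, mul_comm 5]
    refine card_mul_le_card_mul (fun (f : Finset α) (y : α) => y ∈ f) (fun f hf => ?_)
      (fun y hy => ?_)
    · rw [← h.card_four f hf]
      refine card_le_card fun x hx => ?_
      simp only [bipartiteAbove, mem_filter]
      exact ⟨mem_biUnion.2 ⟨f, hf, hx⟩, hx⟩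
    · exact Nat.le_of_lt_succ (hdeg y)

end IsLinearP4Free

theorem LinearQuadSystem.isLinearP4Free {n : ℕ} (H : LinearQuadSystem n)
    (hfree : ¬ ContainsPath 4 H) : IsLinearP4Free H.edges where
  card_four := H.card_four
  linear := H.linear
  free a ha b hb c hc d hd hab hbc hcd hac had hbd := by
    refine hfree ⟨![a, b, c, d], ?_, ?_, ?_⟩
    · intro i
      fin_cases i <;> simpa
    · intro i j hij
      fin_cases i <;> fin_cases j <;> simp_all
    · intro i j hij
      fin_cases i <;> fin_cases j <;> simp_all [disjoint_iff_inter_eq_empty]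

/-- every `P_4`-free linear quadruple system on `n` vertices has at most
`5n/4` quadruples (stated as `4 · |E(H)| ≤ 5n`). -/
theorem linear_turan_P4_upper (n : ℕ) (H : LinearQuadSystem n)
    (hfree : ¬ ContainsPath 4 H) : 4 * H.edges.card ≤ 5 * n := by
  have h1 := (H.isLinearP4Free hfree).four_mul_card_le
  have h2 := card_le_univ (H.edges.biUnion id)
  rw [Fintype.card_fin] at h2
  omega
end
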